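/- Let n ≥ 3, 0 < α < 1 and 2−n < γ < 0. For every f ∈ C^{0,α}_{γ−2}(ℝⁿ₊) and every f̄ ∈ C^{1,α}_{γ−1}(∂ℝⁿ₊) there exists a unique u ∈ C^{2,α}_γ(ℝⁿ₊) satisfying Δu = f on ℝⁿ₊ and ∂u/∂xₙ = f̄ on ∂ℝⁿ₊. -/

import Mathlib

open MeasureTheory Metric Filter
open scoped ENNReal Topology

noncomputable section

/-- The closed half-space `{x : x k ≥ 0}`, where `k` is the distinguished (last) coordinate. -/
def upperHalf (n : ℕ) (k : Fin n) : Set (EuclideanSpace ℝ (Fin n)) := {x | 0 ≤ x k}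

/-- Membership in the weighted space `C^k_γ(S)`. -/
def MemCgamma (m : ℕ) (k : ℕ) (γ : ℝ) (S : Set (EuclideanSpace ℝ (Fin m)))
    (u : EuclideanSpace ℝ (Fin m) → ℝ) : Prop :=
  ContDiffOn ℝ k u S ∧
    ∀ i, i ≤ k → ∃ M : ℝ, ∀ x ∈ S,
      (1 + ‖x‖) ^ (-γ + (i : ℝ)) * ‖iteratedFDerivWithin ℝ i u S x‖ ≤ M

/-- Membership in the weighted Hölder space `C^{k,α}_γ(S)`: the weighted `C^k_γ` norm is
finite and the weighted Hölder seminorm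
`sup (min(ρ(x),ρ(y)))^{-γ+k+α} ‖D^k u(x) - D^k u(y)‖ / |x-y|^α` (over pairs `x ≠ y` in `S`
with `|x-y| ≤ min(ρ(x),ρ(y))/2`) is finite. -/
def WMemHolder (m : ℕ) (k : ℕ) (α γ : ℝ) (S : Set (EuclideanSpace ℝ (Fin m)))
    (u : EuclideanSpace ℝ (Fin m) → ℝ) : Prop :=
  MemCgamma m k γ S u ∧
    ∃ M : ℝ, ∀ x ∈ S, ∀ y ∈ S, x ≠ y →
      dist x y ≤ min (1 + ‖x‖) (1 + ‖y‖) / 2 →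
        (min (1 + ‖x‖) (1 + ‖y‖)) ^ (-γ + (k : ℝ) + α) *
            ‖iteratedFDerivWithin ℝ k u S x - iteratedFDerivWithin ℝ k u S y‖ ≤
          M * dist x y ^ α

/-- The Euclidean Laplacian `Δu = Σᵢ ∂²u/∂xᵢ²`, computed with derivatives within `S`. -/
def lapWithin (n : ℕ) (S : Set (EuclideanSpace ℝ (Fin n)))
    (u : EuclideanSpace ℝ (Fin n) → ℝ) (x : EuclideanSpace ℝ (Fin n)) : ℝ :=
  ∑ i : Fin n, iteratedFDerivWithin ℝ 2 u S x
    ![EuclideanSpace.single i 1, EuclideanSpace.single i 1]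

/-- The identification of `ℝ^{n-1}` with the boundary hyperplane `{xₙ = 0} ⊂ ℝⁿ`. -/
def emb (n : ℕ) (x' : EuclideanSpace ℝ (Fin (n - 1))) : EuclideanSpace ℝ (Fin n) :=
  ∑ i : Fin (n - 1), x' i • EuclideanSpace.single (Fin.castLE (Nat.sub_le n 1) i) 1

/-- The weighted Hölder condition of order zero, with weight exponent `β`. -/
def WHolder {E V : Type*} [NormedAddCommGroup E] [NormedAddCommGroup V] (α β : ℝ) (S : Set E)
    (g : E → V) : Prop :=
  ∃ C, 0 ≤ C ∧ (∀ x ∈ S, ‖g x‖ ≤ C * (1 + ‖x‖) ^ β) ∧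
    ∀ x ∈ S, ∀ y ∈ S, ∀ m, 0 < m → m ≤ 1 + ‖x‖ → m ≤ 1 + ‖y‖ →
      ‖g x - g y‖ ≤ C * ‖x - y‖ ^ α * m ^ (β - α)

lemma rpow_anti_base {a b c : ℝ} (ha : 0 < a) (hab : a ≤ b) (hc : c ≤ 0) : b ^ c ≤ a ^ c :=
  Real.rpow_le_rpow_of_nonpos ha hab hc

lemma rho_pos {E : Type*} [NormedAddCommGroup E] (x : E) : 0 < 1 + ‖x‖ := by positivity

section WHolder

variable {E V W : Type*} [NormedAddCommGroup E] [NormedAddCommGroup V] [NormedAddCommGroup W]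
  {α β : ℝ} {S : Set E}

lemma WHolder.of_close {g : E → V} (hα : 0 ≤ α) (hβ : β ≤ 0) {c C₁ C₂ : ℝ} (hc : 0 < c)
    (h₁ : ∀ x ∈ S, ‖g x‖ ≤ C₁ * (1 + ‖x‖) ^ β)
    (h₂ : ∀ x ∈ S, ∀ y ∈ S, ∀ m, 0 < m → m ≤ 1 + ‖x‖ → m ≤ 1 + ‖y‖ → ‖x - y‖ ≤ c * m →
      x ≠ y → ‖g x - g y‖ ≤ C₂ * ‖x - y‖ ^ α * m ^ (β - α)) : WHolder α β S g := by
  refine ⟨max 0 (max C₁ (max C₂ (2 * max C₁ 0 * c ^ (-α)))), le_max_left _ _, fun x hx => ?_,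
    fun x hx y hy m hm hmx hmy => ?_⟩
  · refine (h₁ x hx).trans ?_
    gcongr
    exact (le_max_left _ _).trans (le_max_right _ _)
  · rcases eq_or_ne x y with rfl | hxy
    · simp only [sub_self, norm_zero]
      positivity
    rcases le_total (‖x - y‖) (c * m) with h | h
    · refine (h₂ x hx y hy m hm hmx hmy h hxy).trans ?_
      gcongr
      exact (le_max_left _ _).trans ((le_max_right _ _).trans (le_max_right _ _))
    · have hb : ∀ z ∈ S, m ≤ 1 + ‖z‖ → ‖g z‖ ≤ max C₁ 0 * m ^ β := fun z hz hmz =>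
        (h₁ z hz).trans <| by
          have := rpow_anti_base hm hmz hβ
          have h0 : 0 ≤ (1 + ‖z‖) ^ β := by positivity
          have h1 := le_max_left C₁ 0
          have h2 := le_max_right C₁ 0
          nlinarith
      have hcm : (c * m) ^ α ≤ ‖x - y‖ ^ α := by gcongr
      calc ‖g x - g y‖ ≤ ‖g x‖ + ‖g y‖ := norm_sub_le _ _
        _ ≤ max C₁ 0 * m ^ β + max C₁ 0 * m ^ β := add_le_add (hb x hx hmx) (hb y hy hmy)
        _ = (2 * max C₁ 0 * c ^ (-α)) * (c * m) ^ α * m ^ (β - α) := by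
          rw [Real.mul_rpow hc.le hm.le, Real.rpow_neg hc.le, Real.rpow_sub hm]
          have := (Real.rpow_pos_of_pos hc α).ne'
          have := (Real.rpow_pos_of_pos hm α).ne'
          field_simp
          ring
        _ ≤ _ := by
          gcongr
          exact (le_max_right _ _).trans ((le_max_right _ _).trans (le_max_right _ _))

lemma WHolder.add {g h : E → V} (hg : WHolder α β S g) (hh : WHolder α β S h) :
    WHolder α β S (fun x => g x + h x) := by
  obtain ⟨C, hC, h₁, h₂⟩ := hg
  obtain ⟨D, hD, k₁, k₂⟩ := hh
  refine ⟨C + D, by positivity, fun x hx => ?_, fun x hx y hy m hm hmx hmy => ?_⟩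
  · rw [add_mul]
    exact (norm_add_le _ _).trans (add_le_add (h₁ x hx) (k₁ x hx))
  · rw [add_sub_add_comm, add_mul, add_mul]
    exact (norm_add_le _ _).trans (add_le_add (h₂ x hx y hy m hm hmx hmy) (k₂ x hx y hy m hm hmx hmy))

lemma WHolder.clm_comp [NormedSpace ℝ V] [NormedSpace ℝ W] {g : E → V} (L : V →L[ℝ] W)
    (hg : WHolder α β S g) : WHolder α β S (fun x => L (g x)) := by
  obtain ⟨C, hC, h₁, h₂⟩ := hg
  refine ⟨‖L‖ * C, by positivity, fun x hx => ?_, fun x hx y hy m hm hmx hmy => ?_⟩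
  · rw [mul_assoc]
    exact L.le_opNorm_of_le (h₁ x hx)
  · rw [← map_sub, mul_assoc, mul_assoc, ← mul_assoc C]
    exact L.le_opNorm_of_le (h₂ x hx y hy m hm hmx hmy)

lemma WHolder.continuousOn {g : E → V} (hα : 0 < α) (hg : WHolder α β S g) :
    ContinuousOn g S := by
  obtain ⟨C, hC, -, h₂⟩ := hg
  intro x hx
  rw [ContinuousWithinAt, tendsto_iff_norm_sub_tendsto_zero]
  have hlim : Tendsto (fun y => C * ‖y - x‖ ^ α * (1 : ℝ) ^ (β - α)) (𝓝[S] x) (𝓝 0) := by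
    have : ContinuousAt (fun y => C * ‖y - x‖ ^ α * (1 : ℝ) ^ (β - α)) x := by
      refine ContinuousAt.mul (ContinuousAt.mul continuousAt_const ?_) continuousAt_const
      exact ContinuousAt.rpow_const (by fun_prop) (Or.inr hα.le)
    simpa [ContinuousAt, Real.zero_rpow hα.ne'] using this.tendsto.mono_left nhdsWithin_le_nhds
  refine squeeze_zero' (Eventually.of_forall fun _ => norm_nonneg _) ?_ hlim
  filter_upwards [self_mem_nhdsWithin] with y hy
  exact h₂ y hy x hx 1 one_pos (by simp) (by simp)

end WHolder

section ScaleAverage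

variable {m : ℕ} {V : Type*} [NormedAddCommGroup V] [NormedSpace ℝ V]
  {E : Type*} [NormedAddCommGroup E] [NormedSpace ℝ E]

/-- The average of `F` around `x` at scale `t` against the kernel `K`. -/
def scaleAvg (F : EuclideanSpace ℝ (Fin m) → ℝ) (K : EuclideanSpace ℝ (Fin m) → V) (t : ℝ)
    (x : EuclideanSpace ℝ (Fin m)) : V :=
  ∫ z, F (x - t • z) • K z

/-- A smooth kernel supported in the closed unit ball. -/
structure UnitKernel (K : EuclideanSpace ℝ (Fin m) → V) : Prop where
  smooth : ContDiff ℝ (⊤ : ℕ∞) K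
  supp : ∀ z, 1 < ‖z‖ → K z = 0

/-- The kernel of the derivative of `p ↦ (τ p) ^ (m - c) • scaleAvg F K (τ p) (π p)`. -/
def kerDiff (π : E →L[ℝ] EuclideanSpace ℝ (Fin m)) (τ : E →L[ℝ] ℝ) (c : ℝ)
    (K : EuclideanSpace ℝ (Fin m) → V) (z : EuclideanSpace ℝ (Fin m)) : E →L[ℝ] V :=
  (fderiv ℝ K z).comp π - τ.smulRight (c • K z + fderiv ℝ K z z)

lemma UnitKernel.continuous {K : EuclideanSpace ℝ (Fin m) → V} (hK : UnitKernel K) :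
    Continuous K := hK.smooth.continuous

lemma UnitKernel.hasCompactSupport {K : EuclideanSpace ℝ (Fin m) → V} (hK : UnitKernel K) :
    HasCompactSupport K :=
  HasCompactSupport.intro (isCompact_closedBall 0 1) fun z hz => hK.supp z <| by
    simpa using hz

lemma UnitKernel.hasFDerivAt {K : EuclideanSpace ℝ (Fin m) → V} (hK : UnitKernel K)
    (z : EuclideanSpace ℝ (Fin m)) : HasFDerivAt K (fderiv ℝ K z) z :=
  (hK.smooth.differentiable (by simp) z).hasFDerivAt

lemma UnitKernel.fderiv {K : EuclideanSpace ℝ (Fin m) → V} (hK : UnitKernel K) :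
    UnitKernel (fderiv ℝ K) where
  smooth := hK.smooth.fderiv_right (by simp)
  supp z hz := by
    have : K =ᶠ[𝓝 z] fun _ => 0 := by
      filter_upwards [(isOpen_lt continuous_const continuous_norm).mem_nhds hz] with y hy
      exact hK.supp y hy
    rw [this.fderiv_eq]
    simp

lemma UnitKernel.kerDiff {K : EuclideanSpace ℝ (Fin m) → V} (hK : UnitKernel K)
    (π : E →L[ℝ] EuclideanSpace ℝ (Fin m)) (τ : E →L[ℝ] ℝ) (c : ℝ) :
    UnitKernel (kerDiff π τ c K) where
  smooth := by
    have h1 := hK.smooth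
    have h2 := hK.fderiv.smooth
    have h3 : ContDiff ℝ (⊤ : ℕ∞) fun z => c • K z + _root_.fderiv ℝ K z z :=
      (contDiff_const.smul h1).add (h2.clm_apply contDiff_id)
    have h4 : ContDiff ℝ (⊤ : ℕ∞) fun z => τ.smulRight (c • K z + _root_.fderiv ℝ K z z) :=
      (ContinuousLinearMap.smulRightL ℝ E V τ).contDiff.comp h3
    have h5 : ContDiff ℝ (⊤ : ℕ∞) fun z => (_root_.fderiv ℝ K z).comp π := h2.clm_comp contDiff_const
    exact h5.sub h4
  supp z hz := by
    simp [_root_.kerDiff, hK.supp z hz, hK.fderiv.supp z hz]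

lemma UnitKernel.clm_comp {W : Type*} [NormedAddCommGroup W] [NormedSpace ℝ W]
    {K : EuclideanSpace ℝ (Fin m) → V} (hK : UnitKernel K) (L : V →L[ℝ] W) :
    UnitKernel (fun z => L (K z)) where
  smooth := L.contDiff.comp hK.smooth
  supp z hz := by simp [hK.supp z hz]

lemma UnitKernel.exists_bound {K : EuclideanSpace ℝ (Fin m) → V} (hK : UnitKernel K) :
    ∃ C, 0 ≤ C ∧ ∀ z, ‖K z‖ ≤ C := by
  obtain ⟨C, hC⟩ := hK.hasCompactSupport.exists_bound_of_continuous hK.continuous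
  exact ⟨C, (norm_nonneg _).trans (hC 0), hC⟩

lemma UnitKernel.integrable {K : EuclideanSpace ℝ (Fin m) → V} (hK : UnitKernel K) :
    Integrable K := hK.continuous.integrable_of_hasCompactSupport hK.hasCompactSupport

lemma UnitKernel.integrable_smul {K : EuclideanSpace ℝ (Fin m) → V} (hK : UnitKernel K)
    {G : EuclideanSpace ℝ (Fin m) → ℝ} (hG : Continuous G) : Integrable fun z => G z • K z :=
  (hG.smul hK.continuous).integrable_of_hasCompactSupport hK.hasCompactSupport.smul_left

lemma scaleAvg_eq_convolution (F : EuclideanSpace ℝ (Fin m) → ℝ)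
    (K : EuclideanSpace ℝ (Fin m) → V) (c : ℝ) {t : ℝ} (ht : 0 < t)
    (x : EuclideanSpace ℝ (Fin m)) :
    (convolution F (fun y => t ^ (-c) • K (t⁻¹ • y)) (ContinuousLinearMap.lsmul ℝ ℝ) volume) x =
      t ^ ((m : ℝ) - c) • scaleAvg F K t x := by
  have h1 := integral_sub_left_eq_self
    (fun y => F y • (t ^ (-c) • K (t⁻¹ • (x - y)))) volume x
  have h2 := Measure.integral_comp_smul_of_nonneg volume
    (fun y => F (x - y) • (t ^ (-c) • K (t⁻¹ • y))) t (hR := ht.le)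
  simp only [sub_sub_cancel] at h1
  simp only [convolution_def, ContinuousLinearMap.lsmul_apply]
  rw [← h1]
  have h3 : (∫ y, F (x - y) • (t ^ (-c) • K (t⁻¹ • y))) =
      t ^ m • ∫ z, F (x - t • z) • (t ^ (-c) • K (t⁻¹ • t • z)) := by
    rw [h2, smul_smul, finrank_euclideanSpace_fin, mul_inv_cancel₀ (by positivity), one_smul]
  rw [h3]
  simp only [smul_smul t⁻¹ t, inv_mul_cancel₀ ht.ne', one_smul, smul_comm (_ : ℝ) (t ^ (-c))]
  rw [integral_smul, smul_smul, scaleAvg]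
  congr 1
  rw [sub_eq_add_neg, Real.rpow_add ht, Real.rpow_natCast]

lemma hasFDerivAt_scaleAvg_prod [CompleteSpace V] {F : EuclideanSpace ℝ (Fin m) → ℝ} (hF : Continuous F)
    {K : EuclideanSpace ℝ (Fin m) → V} (hK : UnitKernel K) (c : ℝ) {t : ℝ} (ht : 0 < t)
    (x : EuclideanSpace ℝ (Fin m)) :
    HasFDerivAt (fun q : ℝ × EuclideanSpace ℝ (Fin m) =>
        q.1 ^ ((m : ℝ) - c) • scaleAvg F K q.1 q.2)
      (t ^ ((m : ℝ) - c - 1) • scaleAvg F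
        (kerDiff (ContinuousLinearMap.snd ℝ ℝ (EuclideanSpace ℝ (Fin m)))
          (ContinuousLinearMap.fst ℝ ℝ _) c K) t x) (t, x) := by
  let g : ℝ → EuclideanSpace ℝ (Fin m) → V := fun s y => s ^ (-c) • K (s⁻¹ • y)
  have hg : ∀ s : ℝ, 0 < s → ∀ y : EuclideanSpace ℝ (Fin m), HasFDerivAt (↿g)
      (s ^ (-(c + 1)) • kerDiff (ContinuousLinearMap.snd ℝ ℝ (EuclideanSpace ℝ (Fin m)))
          (ContinuousLinearMap.fst ℝ ℝ _) c K (s⁻¹ • y)) (s, y) := by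
    intro s hs y
    have e0 : HasFDerivAt (Prod.fst : ℝ × EuclideanSpace ℝ (Fin m) → ℝ)
      (ContinuousLinearMap.fst ℝ ℝ _) (s, y) := hasFDerivAt_fst
    have e1 := ((hasDerivAt_inv hs.ne').comp_hasFDerivAt (s, y) e0).smul
      (hasFDerivAt_snd (p := (s, y)) (𝕜 := ℝ))
    have e2 := (Real.hasDerivAt_rpow_const (p := -c) (Or.inl hs.ne')).comp_hasFDerivAt (s, y) e0
    have e3 := e2.smul ((hK.hasFDerivAt (s⁻¹ • y)).comp (s, y) e1)
    refine HasFDerivAt.congr_fderiv (f := ↿g) e3 ?_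
    refine ContinuousLinearMap.ext fun p => ?_
    have hp : s ^ (-c - 1) = s ^ (-c) * s⁻¹ := by
      rw [Real.rpow_sub hs, Real.rpow_one, div_eq_mul_inv]
    have hp' : s ^ (-1 + -c) = s ^ (-c) * s⁻¹ := by rw [← hp]; ring_nf
    simp [kerDiff, hp, hp', smul_smul, smul_sub]
    match_scalars <;> field_simp
  have hgc : ContDiffOn ℝ 1 ↿g (Set.Ioo (t / 2) (2 * t) ×ˢ Set.univ) := by
    have : ContDiffOn ℝ (⊤ : ℕ∞) ↿g (Set.Ioo (t / 2) (2 * t) ×ˢ Set.univ) := by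
      intro q hq
      have hq' : 0 < q.1 := lt_trans (by positivity) hq.1.1
      have a1 : ContDiffAt ℝ (⊤ : ℕ∞) (fun q : ℝ × EuclideanSpace ℝ (Fin m) => q.1 ^ (-c)) q :=
        ContDiffAt.rpow_const_of_ne contDiffAt_fst hq'.ne'
      have a2 : ContDiffAt ℝ (⊤ : ℕ∞) (fun q : ℝ × EuclideanSpace ℝ (Fin m) => q.1⁻¹ • q.2) q :=
        (contDiffAt_fst.inv hq'.ne').smul contDiffAt_snd
      exact (a1.smul (hK.smooth.contDiffAt.comp q a2)).contDiffWithinAt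
    exact this.of_le (by exact_mod_cast le_top)
  have key := hasFDerivAt_convolution_right_with_param (ContinuousLinearMap.lsmul ℝ ℝ)
    (μ := volume) (f := F) (g := g) (k := closedBall 0 (2 * t)) isOpen_Ioo (isCompact_closedBall _ _)
    (fun s y hs hy => ?_) hF.locallyIntegrable hgc (t, x) ⟨by simp; linarith, by simp; linarith⟩
  · have hev : (fun q : ℝ × EuclideanSpace ℝ (Fin m) =>
        q.1 ^ ((m : ℝ) - c) • scaleAvg F K q.1 q.2) =ᶠ[𝓝 (t, x)] fun q =>
          (convolution F (g q.1) (ContinuousLinearMap.lsmul ℝ ℝ) volume) q.2 := by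
      filter_upwards [(isOpen_lt continuous_const continuous_fst).mem_nhds
        (show (0 : ℝ) < ((t, x) : ℝ × EuclideanSpace ℝ (Fin m)).1 from ht)] with q hq
      exact (scaleAvg_eq_convolution F K c hq q.2).symm
    refine (key.congr_of_eventuallyEq hev).congr_fderiv ?_
    have h2 := scaleAvg_eq_convolution F (kerDiff (ContinuousLinearMap.snd ℝ ℝ
      (EuclideanSpace ℝ (Fin m))) (ContinuousLinearMap.fst ℝ ℝ _) c K) (c + 1) ht x
    rw [sub_sub, ← h2]
    simp only [convolution_def, (hg t ht _).fderiv]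
    rfl
  · have hs0 : 0 < s := lt_trans (by positivity) hs.1
    have : 1 < ‖s⁻¹ • y‖ := by
      rw [norm_smul, Real.norm_of_nonneg (by positivity), ← div_eq_inv_mul, one_lt_div hs0]
      simp at hy
      exact hs.2.trans hy
    simp [g, hK.supp _ this]

lemma hasFDerivAt_scaleAvg [CompleteSpace V] {F : EuclideanSpace ℝ (Fin m) → ℝ}
    (hF : Continuous F) {K : EuclideanSpace ℝ (Fin m) → V} (hK : UnitKernel K)
    (π : E →L[ℝ] EuclideanSpace ℝ (Fin m)) (τ : E →L[ℝ] ℝ) (c : ℝ) {p : E} (hp : 0 < τ p) :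
    HasFDerivAt (fun q : E => (τ q) ^ ((m : ℝ) - c) • scaleAvg F K (τ q) (π q))
      ((τ p) ^ ((m : ℝ) - c - 1) • scaleAvg F (kerDiff π τ c K) (τ p) (π p)) p := by
  have h1 := hasFDerivAt_scaleAvg_prod hF hK c hp (π p)
  have h2 := h1.comp p (τ.prod π).hasFDerivAt
  refine h2.congr_fderiv ?_
  rw [ContinuousLinearMap.smul_comp]
  congr 1
  have h3 := ((hK.kerDiff (ContinuousLinearMap.snd ℝ ℝ (EuclideanSpace ℝ (Fin m)))
    (ContinuousLinearMap.fst ℝ ℝ _) c).integrable_smul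
      (G := fun z => F (π p - τ p • z)) (by fun_prop))
  have h4 := ContinuousLinearMap.integral_comp_comm
    ((ContinuousLinearMap.compL ℝ E (ℝ × EuclideanSpace ℝ (Fin m)) V).flip (τ.prod π)) h3
  refine Eq.trans h4.symm ?_
  simp only [scaleAvg]
  congr 1

/-- The derivative of `p ↦ scaleAvg F K (τ p) (π p)` when `DF` is the derivative of `F`. -/
def scaleAvgDeriv (DF : EuclideanSpace ℝ (Fin m) → EuclideanSpace ℝ (Fin m) →L[ℝ] ℝ)
    (K : EuclideanSpace ℝ (Fin m) → V) (π : E →L[ℝ] EuclideanSpace ℝ (Fin m)) (τ : E →L[ℝ] ℝ)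
    (p : E) : E →L[ℝ] V :=
  ∫ z, ((DF (π p - τ p • z)).comp (π - τ.smulRight z)).smulRight (K z)

lemma continuous_scaleAvgDeriv_integrand
    {DF : EuclideanSpace ℝ (Fin m) → EuclideanSpace ℝ (Fin m) →L[ℝ] ℝ} (hDF : Continuous DF)
    {K : EuclideanSpace ℝ (Fin m) → V} (hK : UnitKernel K)
    (π : E →L[ℝ] EuclideanSpace ℝ (Fin m)) (τ : E →L[ℝ] ℝ) (p : E) :
    Continuous fun z => ((DF (π p - τ p • z)).comp (π - τ.smulRight z)).smulRight (K z) := by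
  have h1 : Continuous fun z : EuclideanSpace ℝ (Fin m) => τ.smulRight z :=
    (ContinuousLinearMap.smulRightL ℝ E _ τ).continuous
  have h2 : Continuous fun z => (DF (π p - τ p • z)).comp (π - τ.smulRight z) :=
    (hDF.comp (by fun_prop)).clm_comp (continuous_const.sub h1)
  exact ((ContinuousLinearMap.smulRightL ℝ E V).continuous.comp h2).clm_apply hK.continuous

lemma integrable_scaleAvgDeriv_integrand
    {DF : EuclideanSpace ℝ (Fin m) → EuclideanSpace ℝ (Fin m) →L[ℝ] ℝ} (hDF : Continuous DF)
    {K : EuclideanSpace ℝ (Fin m) → V} (hK : UnitKernel K)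
    (π : E →L[ℝ] EuclideanSpace ℝ (Fin m)) (τ : E →L[ℝ] ℝ) (p : E) :
    Integrable fun z => ((DF (π p - τ p • z)).comp (π - τ.smulRight z)).smulRight (K z) := by
  refine (continuous_scaleAvgDeriv_integrand hDF hK π τ p).integrable_of_hasCompactSupport
    (HasCompactSupport.intro (isCompact_closedBall 0 1) fun z hz => ?_)
  rw [hK.supp z (by simpa using hz)]
  ext
  simp

lemma norm_clm_smulRight_le (L : EuclideanSpace ℝ (Fin m) →L[ℝ] ℝ)
    {K : EuclideanSpace ℝ (Fin m) → V} (hK : UnitKernel K)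
    (π : E →L[ℝ] EuclideanSpace ℝ (Fin m)) (τ : E →L[ℝ] ℝ) (z : EuclideanSpace ℝ (Fin m)) :
    ‖(L.comp (π - τ.smulRight z)).smulRight (K z)‖ ≤ ‖L‖ * (‖π‖ + ‖τ‖) * ‖K z‖ := by
  rcases lt_or_ge 1 ‖z‖ with h | h
  · rw [hK.supp z h]
    simp
  · rw [ContinuousLinearMap.norm_smulRight_apply]
    gcongr
    refine (ContinuousLinearMap.opNorm_comp_le _ _).trans ?_
    gcongr
    refine (norm_sub_le _ _).trans ?_
    gcongr
    rw [ContinuousLinearMap.norm_smulRight_apply]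
    exact mul_le_of_le_one_right (norm_nonneg _) h

lemma hasFDerivAt_scaleAvg_of_smooth [CompleteSpace V] {F : EuclideanSpace ℝ (Fin m) → ℝ}
    {DF : EuclideanSpace ℝ (Fin m) → EuclideanSpace ℝ (Fin m) →L[ℝ] ℝ}
    (hF : ∀ x, HasFDerivAt F (DF x) x) (hDF : Continuous DF) {B : ℝ} (hB : ∀ x, ‖DF x‖ ≤ B)
    {K : EuclideanSpace ℝ (Fin m) → V} (hK : UnitKernel K)
    (π : E →L[ℝ] EuclideanSpace ℝ (Fin m)) (τ : E →L[ℝ] ℝ) (p : E) :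
    HasFDerivAt (fun q : E => scaleAvg F K (τ q) (π q)) (scaleAvgDeriv DF K π τ p) p := by
  have hFc : Continuous F := continuous_iff_continuousAt.2 fun x => (hF x).continuousAt
  refine hasFDerivAt_integral_of_dominated_of_fderiv_le
    (bound := fun z => B * (‖π‖ + ‖τ‖) * ‖K z‖)
    (F' := fun p z => ((DF (π p - τ p • z)).comp (π - τ.smulRight z)).smulRight (K z)) univ_mem
    ?_ ?_ ?_ ?_ ?_ ?_
  · exact Eventually.of_forall fun q =>
      (hK.integrable_smul (G := fun z => F (π q - τ q • z)) (by fun_prop)).aestronglyMeasurable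
  · exact hK.integrable_smul (G := fun z => F (π p - τ p • z)) (by fun_prop)
  · exact (integrable_scaleAvgDeriv_integrand hDF hK π τ p).aestronglyMeasurable
  · refine Eventually.of_forall fun z q _ => (norm_clm_smulRight_le _ hK π τ z).trans ?_
    gcongr
    exact hB _
  · exact hK.integrable.norm.const_mul _
  · refine Eventually.of_forall fun z q _ => ?_
    have h1 : HasFDerivAt (fun q : E => π q - τ q • z) (π - τ.smulRight z) q :=
      π.hasFDerivAt.sub (τ.hasFDerivAt.smul_const z)
    exact ((hF _).comp q h1).smul_const (K z)

end ScaleAverage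

section WeightedAverage

variable {m : ℕ} {V : Type*} [NormedAddCommGroup V] [NormedSpace ℝ V]

lemma exists_integral_norm_sub_rpow_le {β : ℝ} (hβ : 0 < β) (hβm : β < m) :
    ∃ C, 0 ≤ C ∧ ∀ w : EuclideanSpace ℝ (Fin m),
      IntegrableOn (fun z => ‖w - z‖ ^ (-β)) (closedBall 0 1) ∧
      ∫ z in closedBall 0 1, ‖w - z‖ ^ (-β) ≤ C := by
  have hm : 0 < m := by
    rcases Nat.eq_zero_or_pos m with rfl | h
    · simp at hβm; linarith
    · exact h
  have : Nonempty (Fin m) := ⟨⟨0, hm⟩⟩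
  have hj : IntegrableOn (fun z : EuclideanSpace ℝ (Fin m) => ‖z‖ ^ (-β)) (ball 0 1) := by
    rw [integrableOn_fun_norm_addHaar (μ := volume) (f := fun r : ℝ => r ^ (-β))]
    have h1 : IntegrableOn (fun y : ℝ => y ^ ((m : ℝ) - 1 - β)) (Set.Ioo 0 1) := by
      rw [← intervalIntegrable_iff_integrableOn_Ioo_of_le zero_le_one]
      exact intervalIntegral.intervalIntegrable_rpow' (by linarith)
    refine h1.congr_fun (fun y hy => ?_) measurableSet_Ioo
    have hy0 : 0 < y := hy.1
    simp only [finrank_euclideanSpace_fin, smul_eq_mul]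
    rw [← Real.rpow_natCast, ← Real.rpow_add hy0, Nat.cast_sub (by omega)]
    simp [sub_eq_add_neg]
  have hj' := hj.integrable_indicator measurableSet_ball
  set j := (ball (0 : EuclideanSpace ℝ (Fin m)) 1).indicator fun z => ‖z‖ ^ (-β) with hjdef
  have hpt : ∀ y, ‖y‖ ^ (-β) ≤ j y + 1 := by
    intro y
    by_cases hy : y ∈ ball (0 : EuclideanSpace ℝ (Fin m)) 1
    · simp [hjdef, Set.indicator_of_mem hy]
    · simp only [hjdef, Set.indicator_of_notMem hy, zero_add]
      exact Real.rpow_le_one_of_one_le_of_nonpos (by simpa using hy) (by linarith)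
  have hj0 : ∀ y, 0 ≤ j y := fun y => Set.indicator_nonneg (fun _ _ => by positivity) _
  have hdom : ∀ w : EuclideanSpace ℝ (Fin m),
      IntegrableOn (fun z => j (w - z) + 1) (closedBall 0 1) := fun w =>
    (hj'.comp_sub_left w).integrableOn.add (integrableOn_const (measure_closedBall_lt_top.ne))
  have hinteg : ∀ w : EuclideanSpace ℝ (Fin m),
      IntegrableOn (fun z => ‖w - z‖ ^ (-β)) (closedBall 0 1) := fun w => by
    refine Integrable.mono' (hdom w) ?_ (Eventually.of_forall fun z => ?_)
    · exact (by fun_prop : Measurable fun z : EuclideanSpace ℝ (Fin m) =>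
        ‖w - z‖ ^ (-β)).aestronglyMeasurable
    · rw [Real.norm_of_nonneg (by positivity)]
      exact hpt _
  refine ⟨(∫ z, j z) + volume.real (closedBall (0 : EuclideanSpace ℝ (Fin m)) 1),
    add_nonneg (integral_nonneg hj0) measureReal_nonneg, fun w => ⟨hinteg w, ?_⟩⟩
  calc ∫ z in closedBall 0 1, ‖w - z‖ ^ (-β)
      ≤ ∫ z in closedBall 0 1, (j (w - z) + 1) :=
        integral_mono (hinteg w) (hdom w) fun z => hpt _
    _ = (∫ z in closedBall 0 1, j (w - z)) + ∫ z in closedBall (0 : EuclideanSpace ℝ (Fin m)) 1, 1 :=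
        integral_add (hj'.comp_sub_left w).integrableOn
          (integrableOn_const (measure_closedBall_lt_top.ne))
    _ ≤ (∫ z, j z) + volume.real (closedBall (0 : EuclideanSpace ℝ (Fin m)) 1) := by
        have := setIntegral_le_integral (s := closedBall 0 1) (hj'.comp_sub_left w)
          (Eventually.of_forall fun z => hj0 (w - z))
        rw [integral_sub_left_eq_self j volume w] at this
        simpa using this

lemma norm_scaleAvg_le_of_ball {F : EuclideanSpace ℝ (Fin m) → ℝ}
    {K : EuclideanSpace ℝ (Fin m) → V} (hK : UnitKernel K) {t : ℝ}
    {x : EuclideanSpace ℝ (Fin m)} {B : ℝ} (hB : ∀ z, ‖z‖ ≤ 1 → ‖F (x - t • z)‖ ≤ B) :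
    ‖scaleAvg F K t x‖ ≤ B * ∫ z, ‖K z‖ := by
  rw [← integral_const_mul]
  refine norm_integral_le_of_norm_le (hK.integrable.norm.const_mul _) (Eventually.of_forall fun z => ?_)
  rw [norm_smul]
  rcases lt_or_ge 1 ‖z‖ with h | h
  · simp [hK.supp z h]
  · gcongr
    exact hB z h

lemma half_rho_le {E : Type*} [NormedAddCommGroup E] [NormedSpace ℝ E] {x z : E} {t c : ℝ}
    (ht : 0 ≤ t) (htx : t ≤ c * (1 + ‖x‖)) (hz : ‖z‖ ≤ 1) :
    (1 - c) * (1 + ‖x‖) ≤ 1 + ‖x - t • z‖ := by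
  have h1 : ‖x‖ ≤ ‖x - t • z‖ + ‖t • z‖ := by simpa using norm_add_le (x - t • z) (t • z)
  rw [norm_smul, Real.norm_of_nonneg ht] at h1
  nlinarith [norm_nonneg x, norm_nonneg z]

/-- Averages of a function decaying like `(1 + ‖x‖) ^ (-β)`, `β < m`, decay at the same rate
in the scale and in the centre. -/
lemma exists_norm_scaleAvg_le {β : ℝ} (hβ : 0 < β) (hβm : β < m)
    {F : EuclideanSpace ℝ (Fin m) → ℝ} {B : ℝ}
    (hB : ∀ x, ‖F x‖ ≤ B * (1 + ‖x‖) ^ (-β))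
    {K : EuclideanSpace ℝ (Fin m) → V} (hK : UnitKernel K) :
    ∃ C, 0 ≤ C ∧ (∀ t x, 0 < t → ‖scaleAvg F K t x‖ ≤ C * t ^ (-β)) ∧
      ∀ t x, 0 ≤ t → ‖scaleAvg F K t x‖ ≤ C * (1 + ‖x‖) ^ (-β) := by
  obtain ⟨D, hD, hDb⟩ := exists_integral_norm_sub_rpow_le hβ hβm
  obtain ⟨k, hk, hkb⟩ := hK.exists_bound
  have hm : 0 < m := by
    rcases Nat.eq_zero_or_pos m with rfl | h
    · simp at hβm; linarith
    · exact h
  have : Nonempty (Fin m) := ⟨⟨0, hm⟩⟩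
  have hB0 : 0 ≤ B := by simpa using (norm_nonneg _).trans (hB 0)
  have h1 : ∀ t x, 0 < t → ‖scaleAvg F K t x‖ ≤ B * k * D * t ^ (-β) := by
    intro t x ht
    have e1 : scaleAvg F K t x = ∫ z in closedBall 0 1, F (x - t • z) • K z := by
      rw [scaleAvg, setIntegral_eq_integral_of_forall_compl_eq_zero]
      intro z hz
      rw [hK.supp z (by simpa using hz), smul_zero]
    rw [e1]
    have hae : ∀ᵐ z : EuclideanSpace ℝ (Fin m) ∂(volume.restrict (closedBall 0 1)),
        z ≠ t⁻¹ • x := ae_restrict_of_ae (by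
      rw [ae_iff]; simp)
    calc _ ≤ ∫ z in closedBall 0 1, B * k * t ^ (-β) * ‖t⁻¹ • x - z‖ ^ (-β) := by
          refine norm_integral_le_of_norm_le ((hDb (t⁻¹ • x)).1.const_mul _) ?_
          filter_upwards [hae] with z hz
          have hpos : 0 < ‖t⁻¹ • x - z‖ := norm_pos_iff.2 (sub_ne_zero.2 hz.symm)
          have e2 : ‖x - t • z‖ = t * ‖t⁻¹ • x - z‖ := by
            rw [← Real.norm_of_nonneg ht.le, ← norm_smul, smul_sub, Real.norm_of_nonneg ht.le,
              smul_smul, mul_inv_cancel₀ ht.ne', one_smul]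
          have e3 : (1 + ‖x - t • z‖) ^ (-β) ≤ t ^ (-β) * ‖t⁻¹ • x - z‖ ^ (-β) := by
            rw [← Real.mul_rpow ht.le hpos.le, ← e2]
            refine rpow_anti_base (by rw [e2]; positivity) (by linarith) (by linarith)
          rw [norm_smul]
          calc _ ≤ (B * (t ^ (-β) * ‖t⁻¹ • x - z‖ ^ (-β))) * k := by
                gcongr
                · exact (hB _).trans (by gcongr)
                · exact hkb z
            _ = _ := by ring
      _ = B * k * t ^ (-β) * ∫ z in closedBall 0 1, ‖t⁻¹ • x - z‖ ^ (-β) := integral_const_mul _ _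
      _ ≤ B * k * t ^ (-β) * D := by
          gcongr
          exact (hDb _).2
      _ = _ := by ring
  set C := max (B * k * D * (1 / 2) ^ (-β)) (B * (1 / 2) ^ (-β) * ∫ z, ‖K z‖)
  have hC0 : 0 ≤ C := le_trans (by positivity) (le_max_left _ _)
  have hCD : B * k * D ≤ C := by
    refine le_trans ?_ (le_max_left _ _)
    refine le_mul_of_one_le_right (by positivity) ?_
    exact Real.one_le_rpow_of_pos_of_le_one_of_nonpos (by norm_num) (by norm_num) (by linarith)
  refine ⟨C, hC0, fun t x ht => (h1 t x ht).trans (by gcongr), fun t x ht => ?_⟩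
  have hρ := rho_pos x
  rcases le_total t (1 / 2 * (1 + ‖x‖)) with h | h
  · refine (norm_scaleAvg_le_of_ball hK (B := B * ((1 / 2) * (1 + ‖x‖)) ^ (-β))
      fun z hz => (hB _).trans ?_).trans ?_
    · gcongr ?_ * ?_
      refine rpow_anti_base (by positivity) ?_ (by linarith)
      have := half_rho_le ht h hz
      linarith
    · rw [Real.mul_rpow (by norm_num) hρ.le, mul_right_comm, ← mul_assoc,]
      gcongr
      rw [mul_right_comm]
      refine (le_of_eq ?_).trans (le_max_right _ _)
      ring
  · have ht0 : 0 < t := lt_of_lt_of_le (by positivity) h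
    calc _ ≤ B * k * D * t ^ (-β) := h1 t x ht0
      _ ≤ B * k * D * (1 / 2 * (1 + ‖x‖)) ^ (-β) := by
        gcongr ?_ * ?_
        exact rpow_anti_base (by positivity) h (by linarith)
      _ = (B * k * D * (1 / 2) ^ (-β)) * (1 + ‖x‖) ^ (-β) := by
        rw [Real.mul_rpow (by norm_num) hρ.le]; ring
      _ ≤ _ := by
        gcongr
        exact le_max_left _ _

/-- Cancellation in the kernel gives decay of the averages at small scales. -/
lemma exists_norm_scaleAvg_le_of_integral_eq_zero [CompleteSpace V] {α β : ℝ} (hα : 0 < α) (hβ : 0 < β) (hβm : β < m)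
    {F : EuclideanSpace ℝ (Fin m) → ℝ} (hF : WHolder α (-β) Set.univ F)
    {K : EuclideanSpace ℝ (Fin m) → V} (hK : UnitKernel K) (hK0 : ∫ z, K z = 0) :
    ∃ C, 0 ≤ C ∧ ∀ t x, 0 < t → ‖scaleAvg F K t x‖ ≤ C * t ^ α * (1 + ‖x‖) ^ (-β - α) := by
  have hFc : Continuous F := continuousOn_univ.1 (hF.continuousOn hα)
  obtain ⟨B, hB0, hB, hB'⟩ := hF
  obtain ⟨D, hD, hDb, -⟩ := exists_norm_scaleAvg_le hβ hβm (fun x => hB x trivial) hK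
  set C := max (B * (1 / 2) ^ (-β - α) * ∫ z, ‖K z‖) (D * (1 / 2) ^ (-β - α))
  have hC0 : 0 ≤ C := le_trans (by positivity) (le_max_right _ _)
  refine ⟨C, hC0, fun t x ht => ?_⟩
  have hρ := rho_pos x
  rcases le_total t (1 / 2 * (1 + ‖x‖)) with h | h
  · have e1 : scaleAvg F K t x = scaleAvg (fun y => F y - F x) K t x := by
      simp only [scaleAvg, sub_smul]
      rw [integral_sub, integral_smul, hK0, smul_zero, sub_zero]
      · exact hK.integrable_smul (G := fun z => F (x - t • z)) (by fun_prop)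
      · exact hK.integrable.smul (F x)
    rw [e1]
    refine (norm_scaleAvg_le_of_ball hK (B := B * t ^ α * ((1 / 2) * (1 + ‖x‖)) ^ (-β - α))
      fun z hz => ?_).trans ?_
    · refine (hB' _ trivial x trivial (1 / 2 * (1 + ‖x‖)) (by positivity) ?_ (by linarith)).trans ?_
      · have := half_rho_le ht.le h hz
        linarith
      · gcongr
        rw [sub_sub_cancel_left, norm_neg, norm_smul, Real.norm_of_nonneg ht.le]
        exact mul_le_of_le_one_right ht.le hz
    · rw [Real.mul_rpow (by norm_num) hρ.le]
      calc _ = (B * (1 / 2) ^ (-β - α) * ∫ z, ‖K z‖) * t ^ α * (1 + ‖x‖) ^ (-β - α) := by ring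
        _ ≤ _ := by
          gcongr
          exact le_max_left _ _
  · calc _ ≤ D * t ^ (-β) := hDb t x ht
      _ = D * t ^ α * t ^ (-β - α) := by rw [Real.rpow_sub ht]; field_simp
      _ ≤ D * t ^ α * (1 / 2 * (1 + ‖x‖)) ^ (-β - α) := by
        gcongr ?_ * ?_
        exact rpow_anti_base (by positivity) h (by linarith)
      _ = (D * (1 / 2) ^ (-β - α)) * t ^ α * (1 + ‖x‖) ^ (-β - α) := by
        rw [Real.mul_rpow (by norm_num) hρ.le]; ring
      _ ≤ _ := by
        gcongr
        exact le_max_right _ _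

end WeightedAverage

section ScalePotential

variable {m : ℕ} {V : Type*} [NormedAddCommGroup V] [NormedSpace ℝ V]

lemma integrableOn_and_norm_integral_Ioi_le {G : ℝ → V} (hG : ContinuousOn G (Set.Ioi 0))
    {a b C C' r : ℝ} (hr : 0 < r) (ha : -1 < a) (hb : b < -1)
    (h1 : ∀ s, 0 < s → s ≤ r → ‖G s‖ ≤ C * s ^ a) (h2 : ∀ s, r < s → ‖G s‖ ≤ C' * s ^ b) :
    IntegrableOn G (Set.Ioi 0) ∧
      ‖∫ s in Set.Ioi 0, G s‖ ≤ C * (r ^ (a + 1) / (a + 1)) + C' * (r ^ (b + 1) / -(b + 1)) := by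
  have i1 : IntegrableOn (fun s : ℝ => C * s ^ a) (Set.Ioc 0 r) := by
    rw [← intervalIntegrable_iff_integrableOn_Ioc_of_le hr.le]
    exact (intervalIntegral.intervalIntegrable_rpow' ha).const_mul C
  have i2 : IntegrableOn (fun s : ℝ => C' * s ^ b) (Set.Ioi r) :=
    (integrableOn_Ioi_rpow_of_lt hb hr).const_mul C'
  have b1 : ∀ᵐ s ∂(volume.restrict (Set.Ioc 0 r)), ‖G s‖ ≤ C * s ^ a :=
    (ae_restrict_iff' measurableSet_Ioc).2 (Eventually.of_forall fun s hs => h1 s hs.1 hs.2)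
  have b2 : ∀ᵐ s ∂(volume.restrict (Set.Ioi r)), ‖G s‖ ≤ C' * s ^ b :=
    (ae_restrict_iff' measurableSet_Ioi).2 (Eventually.of_forall fun s hs => h2 s hs)
  have j1 : IntegrableOn G (Set.Ioc 0 r) := Integrable.mono' i1
    ((hG.mono Set.Ioc_subset_Ioi_self).aestronglyMeasurable measurableSet_Ioc) b1
  have j2 : IntegrableOn G (Set.Ioi r) := Integrable.mono' i2
    ((hG.mono (Set.Ioi_subset_Ioi hr.le)).aestronglyMeasurable measurableSet_Ioi) b2
  rw [← Set.Ioc_union_Ioi_eq_Ioi hr.le]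
  refine ⟨j1.union j2, ?_⟩
  rw [setIntegral_union Set.Ioc_disjoint_Ioi_same measurableSet_Ioi j1 j2]
  refine (norm_add_le _ _).trans (add_le_add ((norm_integral_le_of_norm_le i1 b1).trans ?_)
    ((norm_integral_le_of_norm_le i2 b2).trans ?_))
  · rw [integral_const_mul, ← intervalIntegral.integral_of_le hr.le, integral_rpow (Or.inl ha),
      Real.zero_rpow (by linarith), sub_zero]
  · rw [integral_const_mul, integral_Ioi_rpow_of_lt hb hr, neg_div, div_neg]

lemma clm_scaleAvg [CompleteSpace V] {W : Type*} [NormedAddCommGroup W] [NormedSpace ℝ W]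
    [CompleteSpace W] (L : V →L[ℝ] W)
    {F : EuclideanSpace ℝ (Fin m) → ℝ} (hF : Continuous F) {K : EuclideanSpace ℝ (Fin m) → V}
    (hK : UnitKernel K) (s : ℝ) (x : EuclideanSpace ℝ (Fin m)) :
    L (scaleAvg F K s x) = scaleAvg F (fun z => L (K z)) s x := by
  have h := hK.integrable_smul (G := fun z => F (x - s • z)) (by fun_prop)
  rw [scaleAvg, ← L.integral_comp_comm h]
  simp [scaleAvg]

lemma hasFDerivAt_scaleAvg_center [CompleteSpace V] {F : EuclideanSpace ℝ (Fin m) → ℝ}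
    (hF : Continuous F) {K : EuclideanSpace ℝ (Fin m) → V} (hK : UnitKernel K) {s : ℝ} (hs : 0 < s)
    (x : EuclideanSpace ℝ (Fin m)) :
    HasFDerivAt (scaleAvg F K s) (s⁻¹ • scaleAvg F (fderiv ℝ K) s x) x := by
  have h1 := hasFDerivAt_scaleAvg_prod hF hK m hs x
  have h2 := h1.comp x (hasFDerivAt_prodMk_right s x)
  simp only [sub_self, Real.rpow_zero, one_smul, zero_sub, Real.rpow_neg_one] at h2
  refine h2.congr_fderiv ?_
  rw [ContinuousLinearMap.smul_comp]
  congr 1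
  have h4 := clm_scaleAvg ((ContinuousLinearMap.compL ℝ (EuclideanSpace ℝ (Fin m))
    (ℝ × EuclideanSpace ℝ (Fin m)) V).flip (ContinuousLinearMap.inr ℝ ℝ _)) hF
    (hK.kerDiff (ContinuousLinearMap.snd ℝ ℝ (EuclideanSpace ℝ (Fin m)))
    (ContinuousLinearMap.fst ℝ ℝ _) m) s x
  refine Eq.trans h4 ?_
  congr 1
  ext z v
  simp [kerDiff]

lemma hasDerivAt_scaleAvg_scale [CompleteSpace V] {F : EuclideanSpace ℝ (Fin m) → ℝ}
    (hF : Continuous F) {K : EuclideanSpace ℝ (Fin m) → V} (hK : UnitKernel K) {s : ℝ} (hs : 0 < s)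
    (x : EuclideanSpace ℝ (Fin m)) :
    HasDerivAt (fun s => scaleAvg F K s x)
      (s⁻¹ • scaleAvg F (fun z => -((m : ℝ) • K z + fderiv ℝ K z z)) s x) s := by
  have h1 := hasFDerivAt_scaleAvg_prod hF hK m hs x
  have h2 := (h1.comp s (hasFDerivAt_prodMk_left s x)).hasDerivAt
  simp only [sub_self, Real.rpow_zero, one_smul, zero_sub, Real.rpow_neg_one] at h2
  refine h2.congr_deriv ?_
  have h4 := clm_scaleAvg (ContinuousLinearMap.apply ℝ V ((1, 0) : ℝ × EuclideanSpace ℝ (Fin m)))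
    hF (hK.kerDiff (ContinuousLinearMap.snd ℝ ℝ (EuclideanSpace ℝ (Fin m)))
    (ContinuousLinearMap.fst ℝ ℝ _) m) s x
  have h5 : scaleAvg F (fun z => -((m : ℝ) • K z + fderiv ℝ K z z)) s x = _ := Eq.trans ?_ h4.symm
  · rw [h5]
    simp
  · congr 1
    ext z
    simp [kerDiff]

lemma continuousOn_scaleAvg_scale [CompleteSpace V] {F : EuclideanSpace ℝ (Fin m) → ℝ}
    (hF : Continuous F) {K : EuclideanSpace ℝ (Fin m) → V} (hK : UnitKernel K)
    (x : EuclideanSpace ℝ (Fin m)) : ContinuousOn (fun s => scaleAvg F K s x) (Set.Ioi 0) :=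
  fun _ hs => (hasDerivAt_scaleAvg_scale hF hK hs x).continuousAt.continuousWithinAt

lemma UnitKernel.integral_fderiv_eq_zero [CompleteSpace V] {K : EuclideanSpace ℝ (Fin m) → V}
    (hK : UnitKernel K) : ∫ z, _root_.fderiv ℝ K z = 0 := by
  have h1 := hasFDerivAt_scaleAvg_center (F := fun _ => 1) continuous_const hK one_pos 0
  have h2 : scaleAvg (fun _ => 1) K 1 = fun _ => ∫ z, K z := by
    ext x
    simp [scaleAvg]
  rw [h2] at h1
  simpa [scaleAvg] using h1.unique (hasFDerivAt_const _ _)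

/-- The superposition over all scales `s` of the averages of `F`, with weight `s ^ a`. -/
def scalePot (F : EuclideanSpace ℝ (Fin m) → ℝ) (K : EuclideanSpace ℝ (Fin m) → V) (a : ℝ)
    (x : EuclideanSpace ℝ (Fin m)) : V :=
  ∫ s in Set.Ioi (0 : ℝ), s ^ a • scaleAvg F K s x

lemma norm_rpow_smul_le {s D a b : ℝ} (hs : 0 < s) {v : V} (h : ‖v‖ ≤ D * s ^ b) :
    ‖s ^ a • v‖ ≤ D * s ^ (a + b) := by
  rw [norm_smul, Real.norm_of_nonneg (by positivity), Real.rpow_add hs]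
  calc _ ≤ s ^ a * (D * s ^ b) := by gcongr
    _ = _ := by ring

section Estimates

variable [CompleteSpace V] {α β a : ℝ} {F : EuclideanSpace ℝ (Fin m) → ℝ}
  {K : EuclideanSpace ℝ (Fin m) → V}

lemma continuousOn_scalePot_integrand (hF : Continuous F) (hK : UnitKernel K)
    (x : EuclideanSpace ℝ (Fin m)) :
    ContinuousOn (fun s => s ^ a • scaleAvg F K s x) (Set.Ioi 0) :=
  (continuousOn_id.rpow_const fun _ hs => Or.inl (ne_of_gt hs)).smul
    (continuousOn_scaleAvg_scale hF hK x)

lemma scalePot_bound (hα : 0 < α) (hβ : 0 < β) (hβm : β < m) (haβ : a - β < -1) (ha : -1 < a)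
    (hF : WHolder α (-β) Set.univ F) (hK : UnitKernel K) :
    (∀ x, IntegrableOn (fun s => s ^ a • scaleAvg F K s x) (Set.Ioi 0)) ∧
      ∃ C, 0 ≤ C ∧ ∀ x, ‖scalePot F K a x‖ ≤ C * (1 + ‖x‖) ^ (a + 1 - β) := by
  have hFc : Continuous F := continuousOn_univ.1 (hF.continuousOn hα)
  obtain ⟨B, hB0, hB, -⟩ := hF
  obtain ⟨C, hC, h1, h2⟩ := exists_norm_scaleAvg_le hβ hβm (fun x => hB x trivial) hK
  have key := fun x => integrableOn_and_norm_integral_Ioi_le (a := a + 0) (b := a + -β)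
    (continuousOn_scalePot_integrand (a := a) hFc hK x) (rho_pos x) (by linarith) (by linarith)
    (C := C * (1 + ‖x‖) ^ (-β)) (C' := C)
    (fun s hs _ => norm_rpow_smul_le hs (by simpa using h2 s x hs.le))
    (fun s hs => norm_rpow_smul_le ((rho_pos x).trans hs) (h1 s x ((rho_pos x).trans hs)))
  refine ⟨fun x => (key x).1, C * (1 / (a + 1) + 1 / -(a - β + 1)), ?_, fun x => ?_⟩
  · have e1 : 0 < a + 1 := by linarith
    have e2 : 0 < -(a - β + 1) := by linarith
    positivity
  · refine (key x).2.trans (le_of_eq ?_)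
    have hρ := rho_pos x
    have e1 : (1 + ‖x‖) ^ (-β) * (1 + ‖x‖) ^ (a + 1) = (1 + ‖x‖) ^ (a + 1 - β) := by
      rw [← Real.rpow_add hρ]; congr 1; ring
    have e2 : a + -β + 1 = a + 1 - β := by ring
    have e3 : a - β + 1 = a + 1 - β := by ring
    rw [e2, e3, add_zero, ← e1]
    generalize (1 + ‖x‖) ^ (-β) = u
    generalize (1 + ‖x‖) ^ (a + 1) = v
    ring

lemma scalePot_bound_of_integral_eq_zero (hα : 0 < α) (hβ : 0 < β) (hβm : β < m)
    (haβ : a - β < -1) (ha : -1 < a + α)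
    (hF : WHolder α (-β) Set.univ F) (hK : UnitKernel K) (hK0 : ∫ z, K z = 0) :
    (∀ x, IntegrableOn (fun s => s ^ a • scaleAvg F K s x) (Set.Ioi 0)) ∧
      ∃ C, 0 ≤ C ∧ ∀ x, ‖scalePot F K a x‖ ≤ C * (1 + ‖x‖) ^ (a + 1 - β) := by
  have hFc : Continuous F := continuousOn_univ.1 (hF.continuousOn hα)
  obtain ⟨C₀, hC₀, h0⟩ := exists_norm_scaleAvg_le_of_integral_eq_zero hα hβ hβm hF hK hK0
  obtain ⟨B, hB0, hB, -⟩ := hF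
  obtain ⟨C, hC, h1, -⟩ := exists_norm_scaleAvg_le hβ hβm (fun x => hB x trivial) hK
  have key := fun x => integrableOn_and_norm_integral_Ioi_le (a := a + α) (b := a + -β)
    (continuousOn_scalePot_integrand (a := a) hFc hK x) (rho_pos x) ha (by linarith)
    (C := C₀ * (1 + ‖x‖) ^ (-β - α)) (C' := C)
    (fun s hs _ => norm_rpow_smul_le hs (by
      rw [mul_right_comm]; exact h0 s x hs))
    (fun s hs => norm_rpow_smul_le ((rho_pos x).trans hs) (h1 s x ((rho_pos x).trans hs)))
  have e1 : 0 < a + α + 1 := by linarith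
  have e2 : 0 < -(a - β + 1) := by linarith
  refine ⟨fun x => (key x).1, C₀ / (a + α + 1) + C / -(a - β + 1), by positivity, fun x => ?_⟩
  · refine (key x).2.trans (le_of_eq ?_)
    have hρ := rho_pos x
    have e1 : (1 + ‖x‖) ^ (-β - α) * (1 + ‖x‖) ^ (a + α + 1) = (1 + ‖x‖) ^ (a + 1 - β) := by
      rw [← Real.rpow_add hρ]; congr 1; ring
    have e2 : a + -β + 1 = a + 1 - β := by ring
    have e3 : a - β + 1 = a + 1 - β := by ring
    rw [e2, e3, ← e1]
    generalize (1 + ‖x‖) ^ (-β - α) = u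
    generalize (1 + ‖x‖) ^ (a + α + 1) = v
    ring

lemma hasFDerivAt_scalePot (hα : 0 < α) (hα1 : α < 1) (hβ : 2 < β) (hβm : β < m) (ha0 : 0 ≤ a)
    (ha1 : a ≤ 1) (hF : WHolder α (-β) Set.univ F) (hK : UnitKernel K)
    (hinteg : ∀ x, IntegrableOn (fun s => s ^ a • scaleAvg F K s x) (Set.Ioi 0))
    (x : EuclideanSpace ℝ (Fin m)) :
    HasFDerivAt (scalePot F K a) (scalePot F (fderiv ℝ K) (a - 1) x) x := by
  have hFc : Continuous F := continuousOn_univ.1 (hF.continuousOn hα)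
  obtain ⟨C₀, hC₀, h0⟩ := exists_norm_scaleAvg_le_of_integral_eq_zero hα (by linarith) hβm hF
    hK.fderiv hK.integral_fderiv_eq_zero
  obtain ⟨B, hB0, hB, -⟩ := hF
  obtain ⟨C, hC, h1, -⟩ := exists_norm_scaleAvg_le (by linarith) hβm (fun x => hB x trivial)
    hK.fderiv
  set bd : ℝ → ℝ := fun s => min (C₀ * s ^ (a - 1 + α)) (C * s ^ (a - 1 + -β)) with hbd
  have hbd0 : ∀ s, 0 < s → ‖bd s‖ = bd s := fun s hs => Real.norm_of_nonneg (by positivity)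
  have hbdc : ContinuousOn bd (Set.Ioi 0) := by
    have : ∀ b : ℝ, ContinuousOn (fun s : ℝ => s ^ b) (Set.Ioi 0) := fun b =>
      continuousOn_id.rpow_const fun _ hs => Or.inl (ne_of_gt hs)
    exact ContinuousOn.inf (continuousOn_const.mul (this _)) (continuousOn_const.mul (this _))
  have hbdi : IntegrableOn bd (Set.Ioi 0) :=
    (integrableOn_and_norm_integral_Ioi_le hbdc one_pos (a := a - 1 + α) (b := a - 1 + -β)
      (by linarith) (by linarith) (fun s hs _ => (hbd0 s hs).trans_le (min_le_left _ _))
      (fun s hs => (hbd0 s (by linarith)).trans_le (min_le_right _ _))).1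
  refine hasFDerivAt_integral_of_dominated_of_fderiv_le (bound := bd)
    (F' := fun x s => s ^ (a - 1) • scaleAvg F (fderiv ℝ K) s x) univ_mem
    (Eventually.of_forall fun y => (hinteg y).aestronglyMeasurable) (hinteg x)
    ((continuousOn_scalePot_integrand hFc hK.fderiv x).aestronglyMeasurable measurableSet_Ioi)
    ?_ hbdi ?_
  · refine (ae_restrict_iff' measurableSet_Ioi).2 (Eventually.of_forall fun s hs y _ => ?_)
    refine le_min (norm_rpow_smul_le hs ((h0 s y hs).trans ?_)) (norm_rpow_smul_le hs (h1 s y hs))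
    refine mul_le_of_le_one_right (mul_nonneg hC₀ (Real.rpow_nonneg (le_of_lt hs) _)) ?_
    exact Real.rpow_le_one_of_one_le_of_nonpos (by simp) (by linarith)
  · refine (ae_restrict_iff' measurableSet_Ioi).2 (Eventually.of_forall fun s hs y _ => ?_)
    have h := (hasFDerivAt_scaleAvg_center hFc hK hs y).const_smul (s ^ a)
    rwa [smul_smul, ← Real.rpow_neg_one, ← Real.rpow_add hs] at h

lemma wHolder_scalePot (hα : 0 < α) (hα1 : α < 1) (hβ : 0 < β) (hβm : β < m)
    (hF : WHolder α (-β) Set.univ F) (hK : UnitKernel K) (hK0 : ∫ z, K z = 0) :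
    WHolder α (-β) Set.univ (scalePot F K (-1)) := by
  have hFc : Continuous F := continuousOn_univ.1 (hF.continuousOn hα)
  obtain ⟨hinteg, C, hC, hCb⟩ := scalePot_bound_of_integral_eq_zero (a := -1) hα hβ hβm (by linarith)
    (by linarith) hF hK hK0
  obtain ⟨C₀, hC₀, h0⟩ := exists_norm_scaleAvg_le_of_integral_eq_zero hα hβ hβm hF hK hK0
  obtain ⟨C₁, hC₁, h1⟩ := exists_norm_scaleAvg_le_of_integral_eq_zero hα hβ hβm hF hK.fderiv
    hK.integral_fderiv_eq_zero
  refine WHolder.of_close hα.le (by linarith) (c := 1 / 2) (by norm_num) (C₁ := C)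
    (C₂ := 2 * C₀ / α + C₁ * (1 / 2) ^ (-β - α) / (1 - α)) (fun x _ => by simpa using hCb x) ?_
  intro x _ y _ M hM hMx hMy hd hxy
  have hd0 : 0 < ‖x - y‖ := norm_pos_iff.2 (sub_ne_zero.2 hxy)
  rw [scalePot, scalePot, ← integral_sub (hinteg x) (hinteg y)]
  have hsub : ∀ s : ℝ, s ^ (-1 : ℝ) • scaleAvg F K s x - s ^ (-1 : ℝ) • scaleAvg F K s y =
      s ^ (-1 : ℝ) • (scaleAvg F K s x - scaleAvg F K s y) := fun s => (smul_sub _ _ _).symm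
  have hle : ∀ z, M ≤ 1 + ‖z‖ → ∀ s, 0 < s →
      ‖scaleAvg F K s z‖ ≤ C₀ * s ^ α * M ^ (-β - α) := fun z hz s hs =>
    (h0 s z hs).trans <| by
      gcongr ?_ * ?_
      exact rpow_anti_base hM hz (by linarith)
  refine (integrableOn_and_norm_integral_Ioi_le (a := -1 + α) (b := -1 + (α - 1))
    (C := 2 * C₀ * M ^ (-β - α)) (C' := C₁ * (1 / 2 * M) ^ (-β - α) * ‖x - y‖)
    ((continuousOn_scalePot_integrand hFc hK x).sub (continuousOn_scalePot_integrand hFc hK y))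
    hd0 (by linarith) (by linarith) (fun s hs _ => ?_) (fun s hs => ?_)).2.trans (le_of_eq ?_)
  · simp only [Pi.sub_apply, hsub]
    refine norm_rpow_smul_le hs ((norm_sub_le _ _).trans ?_)
    linarith [hle x hMx s hs, hle y hMy s hs]
  · simp only [Pi.sub_apply, hsub]
    have hs0 : 0 < s := hd0.trans hs
    refine norm_rpow_smul_le hs0 ?_
    refine ((convex_segment y x).norm_image_sub_le_of_norm_hasFDerivWithin_le
      (fun z _ => (hasFDerivAt_scaleAvg_center hFc hK hs0 z).hasFDerivWithinAt)
      (C := C₁ * (1 / 2 * M) ^ (-β - α) * s ^ (α - 1)) (fun z hz => ?_)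
      (left_mem_segment ℝ y x) (right_mem_segment ℝ y x)).trans (le_of_eq (by ring))
    have hz1 := norm_sub_le_of_mem_segment hz
    have hz2 : ‖y‖ ≤ ‖z‖ + ‖z - y‖ := by
      rw [norm_sub_rev]; simpa using norm_add_le z (y - z)
    rw [norm_smul, Real.norm_of_nonneg (by positivity)]
    calc _ ≤ s⁻¹ * (C₁ * s ^ α * (1 / 2 * M) ^ (-β - α)) := by
          gcongr
          refine (h1 s z hs0).trans ?_
          gcongr ?_ * ?_
          exact rpow_anti_base (by positivity) (by linarith) (by linarith)
      _ = _ := by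
          rw [Real.rpow_sub hs0, Real.rpow_one]
          field_simp
  · have e1 : -1 + α + 1 = α := by ring
    have e2 : -1 + (α - 1) + 1 = α - 1 := by ring
    have e3 : (1 : ℝ) - α ≠ 0 := by linarith
    rw [e1, e2, Real.mul_rpow (by norm_num) hM.le, Real.rpow_sub hd0 α, Real.rpow_one, neg_sub]
    have := hα.ne'
    field_simp

lemma integral_scaleAvg_scale_deriv (hα : 0 < α) (hβ : 0 < β) (hβm : β < m)
    (hF : WHolder α (-β) Set.univ F) (hK : UnitKernel K) (x : EuclideanSpace ℝ (Fin m))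
    (hinteg : IntegrableOn (fun s : ℝ =>
      s⁻¹ • scaleAvg F (fun z => -((m : ℝ) • K z + fderiv ℝ K z z)) s x) (Set.Ioi 0)) :
    ∫ s in Set.Ioi (0 : ℝ), s⁻¹ • scaleAvg F (fun z => -((m : ℝ) • K z + fderiv ℝ K z z)) s x =
      -(F x • ∫ z, K z) := by
  have hFc : Continuous F := continuousOn_univ.1 (hF.continuousOn hα)
  obtain ⟨B, hB0, hB, -⟩ := hF
  obtain ⟨C, hC, h1, -⟩ := exists_norm_scaleAvg_le hβ hβm (fun x => hB x trivial) hK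
  rw [integral_Ioi_of_hasDerivAt_of_tendsto (f := fun s => scaleAvg F K s x) (m := 0) ?_
    (fun s hs => hasDerivAt_scaleAvg_scale hFc hK hs x) hinteg ?_]
  · simp [scaleAvg, integral_smul]
  · have h3 : (fun s => scaleAvg F K s x) =
        fun s => ∫ z in closedBall 0 1, F (x - s • z) • K z := by
      ext s
      rw [scaleAvg, setIntegral_eq_integral_of_forall_compl_eq_zero]
      intro z hz
      rw [hK.supp z (by simpa using hz), smul_zero]
    rw [h3]
    refine (continuous_parametric_integral_of_continuous ?_
      (isCompact_closedBall _ _)).continuousWithinAt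
    have := hK.continuous
    simp only [Function.uncurry_def]
    fun_prop
  · refine squeeze_zero_norm' ?_ (by simpa using (tendsto_rpow_neg_atTop hβ).const_mul C)
    filter_upwards [eventually_gt_atTop 0] with s hs
    exact h1 s x hs

end Estimates

end ScalePotential

section NewtonPotential

variable {m : ℕ}

lemma exists_radial_kernel (hm : 0 < m) : ∃ Φ φ : EuclideanSpace ℝ (Fin m) → ℝ,
    UnitKernel Φ ∧ UnitKernel φ ∧ 0 < ∫ z, φ z ∧
    (∀ z, HasFDerivAt Φ (-(φ z • innerSL ℝ z)) z) ∧
    ∀ (R : EuclideanSpace ℝ (Fin m) ≃ₗᵢ[ℝ] EuclideanSpace ℝ (Fin m)) z, Φ (R z) = Φ z := by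
  have hg : ContDiff ℝ (⊤ : ℕ∞) expNegInvGlue := expNegInvGlue.contDiff
  have hg' : ContDiff ℝ (⊤ : ℕ∞) (deriv expNegInvGlue) := ContDiff.deriv' (by simpa using hg)
  have hin : ContDiff ℝ (⊤ : ℕ∞) fun z : EuclideanSpace ℝ (Fin m) => 1 - ‖z‖ ^ 2 :=
    contDiff_const.sub (contDiff_norm_sq ℝ)
  have hd0 : ∀ t < 0, deriv expNegInvGlue t = 0 := by
    intro t ht
    have : expNegInvGlue =ᶠ[𝓝 t] fun _ => 0 := by
      filter_upwards [eventually_lt_nhds ht] with y hy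
      exact expNegInvGlue.zero_of_nonpos hy.le
    rw [this.deriv_eq]
    simp
  have hneg : ∀ z : EuclideanSpace ℝ (Fin m), 1 < ‖z‖ → 1 - ‖z‖ ^ 2 < 0 := fun z hz => by
    nlinarith
  have hφ : UnitKernel fun z : EuclideanSpace ℝ (Fin m) =>
      2 * deriv expNegInvGlue (1 - ‖z‖ ^ 2) :=
    ⟨contDiff_const.mul (hg'.comp hin), fun z hz => by rw [hd0 _ (hneg z hz), mul_zero]⟩
  have hφ0 : ∀ z : EuclideanSpace ℝ (Fin m), 0 ≤ 2 * deriv expNegInvGlue (1 - ‖z‖ ^ 2) := fun z =>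
    mul_nonneg zero_le_two expNegInvGlue.monotone.deriv_nonneg
  refine ⟨fun z => expNegInvGlue (1 - ‖z‖ ^ 2), fun z => 2 * deriv expNegInvGlue (1 - ‖z‖ ^ 2),
    ⟨hg.comp hin, fun z hz => expNegInvGlue.zero_of_nonpos (hneg z hz).le⟩, hφ, ?_, ?_, ?_⟩
  · obtain ⟨c, hc, hc'⟩ := exists_deriv_eq_slope expNegInvGlue zero_lt_one
      hg.continuous.continuousOn (hg.differentiable (by simp)).differentiableOn
    have hpos : deriv expNegInvGlue c ≠ 0 := by
      rw [hc', expNegInvGlue.zero]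
      simp
    refine hφ.continuous.integral_pos_of_hasCompactSupport_nonneg_nonzero hφ.hasCompactSupport hφ0
      (x := EuclideanSpace.single ⟨0, hm⟩ (√(1 - c))) ?_
    have h1 : 0 ≤ 1 - c := by linarith [hc.2]
    simpa [Real.sq_sqrt h1] using hpos
  · intro z
    have h1 : HasFDerivAt (fun z : EuclideanSpace ℝ (Fin m) => ‖z‖ ^ 2) (2 • innerSL ℝ z) z :=
      (hasStrictFDerivAt_norm_sq z).hasFDerivAt
    have h2 := ((hg.differentiable (by simp) (1 - ‖z‖ ^ 2)).hasDerivAt).comp_hasFDerivAt z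
      (h1.const_sub 1)
    refine h2.congr_fderiv ?_
    ext v
    simp
    ring
  · intro R z
    simp

lemma sum_fderiv_fderiv_eq {Φ φ : EuclideanSpace ℝ (Fin m) → ℝ} (hφ : UnitKernel φ)
    (hΦ : ∀ z, HasFDerivAt Φ (-(φ z • innerSL ℝ z)) z) (z : EuclideanSpace ℝ (Fin m)) :
    ∑ i, fderiv ℝ (fderiv ℝ Φ) z (EuclideanSpace.single i 1) (EuclideanSpace.single i 1) =
      -((m : ℝ) • φ z + fderiv ℝ φ z z) := by
  have h1 : fderiv ℝ Φ = fun z => -(φ z • innerSL ℝ z) := funext fun z => (hΦ z).fderiv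
  let J : EuclideanSpace ℝ (Fin m) →L[ℝ] EuclideanSpace ℝ (Fin m) →L[ℝ] ℝ := innerSL ℝ
  have h2 : HasFDerivAt (fun z => -(φ z • J z)) (-(φ z • J + (fderiv ℝ φ z).smulRight (J z))) z :=
    ((hφ.hasFDerivAt z).smul J.hasFDerivAt).neg
  have hJa : ∀ v w, J v w = inner ℝ v w := fun v w => innerSL_apply_apply ℝ v w
  have hz : z = ∑ i, z i • EuclideanSpace.single i (1 : ℝ) := by
    simpa using ((EuclideanSpace.basisFun (Fin m) ℝ).sum_repr z).symm
  have h3 : fderiv ℝ φ z z = ∑ i, fderiv ℝ φ z (EuclideanSpace.single i 1) * z i := by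
    refine (congrArg (fderiv ℝ φ z) hz).trans ?_
    rw [map_sum]
    simp [mul_comm]
  rw [h1, HasFDerivAt.fderiv h2, h3]
  simp [Finset.sum_add_distrib, hJa, EuclideanSpace.inner_single_right]

lemma scaleAvg_linearIsometryEquiv {F K : EuclideanSpace ℝ (Fin m) → ℝ}
    (R : EuclideanSpace ℝ (Fin m) ≃ₗᵢ[ℝ] EuclideanSpace ℝ (Fin m))
    (hF : ∀ x, F (R x) = F x) (hK : ∀ x, K (R x) = K x) (s : ℝ) (x : EuclideanSpace ℝ (Fin m)) :
    scaleAvg F K s (R x) = scaleAvg F K s x := by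
  rw [scaleAvg, ← (R.measurePreserving).integral_comp R.toHomeomorph.measurableEmbedding]
  simp only [scaleAvg, hK, ← map_smul, ← map_sub, hF]

/-- Solvability of the Poisson equation in weighted Hölder spaces on the whole space. -/
theorem exists_newton_potential {α γ : ℝ} (hα : 0 < α) (hα1 : α < 1) (hγ₁ : 2 - (m : ℝ) < γ)
    (hγ₂ : γ < 0) {F : EuclideanSpace ℝ (Fin m) → ℝ} (hF : WHolder α (γ - 2) Set.univ F) :
    ∃ (u : EuclideanSpace ℝ (Fin m) → ℝ)
      (U₁ : EuclideanSpace ℝ (Fin m) → EuclideanSpace ℝ (Fin m) →L[ℝ] ℝ)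
      (U₂ : EuclideanSpace ℝ (Fin m) →
        EuclideanSpace ℝ (Fin m) →L[ℝ] EuclideanSpace ℝ (Fin m) →L[ℝ] ℝ),
      (∀ x, HasFDerivAt u (U₁ x) x) ∧ (∀ x, HasFDerivAt U₁ (U₂ x) x) ∧
      (∃ C, ∀ x, ‖u x‖ ≤ C * (1 + ‖x‖) ^ γ) ∧ (∃ C, ∀ x, ‖U₁ x‖ ≤ C * (1 + ‖x‖) ^ (γ - 1)) ∧
      WHolder α (γ - 2) Set.univ U₂ ∧
      (∀ x, ∑ i, U₂ x (EuclideanSpace.single i 1) (EuclideanSpace.single i 1) = F x) ∧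
      ∀ R : EuclideanSpace ℝ (Fin m) ≃ₗᵢ[ℝ] EuclideanSpace ℝ (Fin m), (∀ x, F (R x) = F x) →
        ∀ x, u (R x) = u x := by
  have hm : 0 < m := by
    rcases Nat.eq_zero_or_pos m with rfl | h
    · simp at hγ₁; linarith
    · exact h
  obtain ⟨Φ, φ, hΦ, hφ, hκ, hΦd, hΦR⟩ := exists_radial_kernel hm
  set κ := ∫ z, φ z with hκdef
  have hb : γ - 2 = -(2 - γ) := by ring
  rw [hb] at hF
  have hFc : Continuous F := continuousOn_univ.1 (hF.continuousOn hα)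
  have hβm : 2 - γ < m := by linarith
  have i2 : ∫ z, fderiv ℝ (fderiv ℝ Φ) z = 0 := hΦ.fderiv.integral_fderiv_eq_zero
  obtain ⟨j0, C0, -, b0⟩ := scalePot_bound (a := 1) hα (by linarith) hβm (by linarith)
    (by linarith) hF hΦ
  obtain ⟨j1, C1, -, b1⟩ := scalePot_bound (a := 0) hα (by linarith) hβm (by linarith)
    (by linarith) hF hΦ.fderiv
  obtain ⟨j2, -⟩ := scalePot_bound_of_integral_eq_zero (a := -1) hα (by linarith) hβm
    (by linarith) (by linarith) hF hΦ.fderiv.fderiv i2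
  have d0 := hasFDerivAt_scalePot hα hα1 (by linarith) hβm zero_le_one le_rfl hF hΦ j0
  have d1 := hasFDerivAt_scalePot hα hα1 (by linarith) hβm le_rfl zero_le_one hF hΦ.fderiv j1
  rw [sub_self] at d0
  rw [zero_sub] at d1
  refine ⟨fun x => (-κ⁻¹) • scalePot F Φ 1 x, fun x => (-κ⁻¹) • scalePot F (fderiv ℝ Φ) 0 x,
    fun x => (-κ⁻¹) • scalePot F (fderiv ℝ (fderiv ℝ Φ)) (-1) x, fun x => (d0 x).fun_const_smul _,
    fun x => (d1 x).fun_const_smul (-κ⁻¹), ⟨κ⁻¹ * C0, fun x => ?_⟩, ⟨κ⁻¹ * C1, fun x => ?_⟩, ?_, fun x => ?_,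
    fun R hR x => ?_⟩
  · rw [norm_smul, norm_neg, Real.norm_of_nonneg (by positivity), mul_assoc]
    gcongr
    refine (b0 x).trans_eq ?_
    congr 2; ring
  · rw [norm_smul, norm_neg, Real.norm_of_nonneg (by positivity), mul_assoc]
    gcongr
    refine (b1 x).trans_eq ?_
    congr 2; ring
  · rw [hb]
    exact (wHolder_scalePot hα hα1 (by linarith) hβm hF hΦ.fderiv.fderiv i2).clm_comp
      ((-κ⁻¹) • ContinuousLinearMap.id ℝ _)
  · let T : (EuclideanSpace ℝ (Fin m) →L[ℝ] EuclideanSpace ℝ (Fin m) →L[ℝ] ℝ) →L[ℝ] ℝ :=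
      ∑ i, (ContinuousLinearMap.apply ℝ ℝ (EuclideanSpace.single i 1)).comp
        (ContinuousLinearMap.apply ℝ _ (EuclideanSpace.single i 1))
    have hT : ∀ A, T A = ∑ i, A (EuclideanSpace.single i 1) (EuclideanSpace.single i 1) := by
      intro A; simp [T]
    have e1 : ∀ s, T (s ^ (-1 : ℝ) • scaleAvg F (fderiv ℝ (fderiv ℝ Φ)) s x) =
        s⁻¹ • scaleAvg F (fun z => -((m : ℝ) • φ z + fderiv ℝ φ z z)) s x := by
      intro s
      rw [map_smul, clm_scaleAvg T hFc hΦ.fderiv.fderiv, Real.rpow_neg_one]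
      congr 2
      ext z
      rw [hT, sum_fderiv_fderiv_eq hφ hΦd]
    have e2 := T.integral_comp_comm (j2 x)
    have e3 := T.integrable_comp (j2 x)
    simp only [e1] at e2 e3
    rw [integral_scaleAvg_scale_deriv hα (by linarith) hβm hF hφ x e3] at e2
    rw [← hT, map_smul, scalePot, ← e2]
    simp only [smul_eq_mul, ← hκdef]
    field_simp
  · simp only [scalePot, scaleAvg_linearIsometryEquiv R hR (hΦR R)]

end NewtonPotential

section NeumannExtension

variable {m : ℕ} {E : Type*} [NormedAddCommGroup E] [NormedSpace ℝ E]
  {V : Type*} [NormedAddCommGroup V] [NormedSpace ℝ V] [CompleteSpace V]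

/-- A splitting of `E` into a horizontal part `π` and a height `τ`. -/
structure HeightSplitting (π : E →L[ℝ] EuclideanSpace ℝ (Fin m)) (τ : E →L[ℝ] ℝ) : Prop where
  norm_fst_le : ∀ p, ‖π p‖ ≤ ‖p‖
  abs_snd_le : ∀ p, |τ p| ≤ ‖p‖
  norm_le : ∀ p, ‖p‖ ≤ ‖π p‖ + |τ p|
  exists_one : ∃ e, τ e = 1

variable {π : E →L[ℝ] EuclideanSpace ℝ (Fin m)} {τ : E →L[ℝ] ℝ}
  {α β : ℝ} {h : EuclideanSpace ℝ (Fin m) → ℝ}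
  {Dh : EuclideanSpace ℝ (Fin m) → EuclideanSpace ℝ (Fin m) →L[ℝ] ℝ}

omit [CompleteSpace V] in
lemma HeightSplitting.exists_norm_scaleAvg_le (hs : HeightSplitting π τ) (hβ : 0 < β) (hβm : β < m)
    {B : ℝ} (hB : ∀ x, ‖h x‖ ≤ B * (1 + ‖x‖) ^ (-β)) {K : EuclideanSpace ℝ (Fin m) → V}
    (hK : UnitKernel K) :
    ∃ C, 0 ≤ C ∧ ∀ p, 0 ≤ τ p → ‖scaleAvg h K (τ p) (π p)‖ ≤ C * (1 + ‖p‖) ^ (-β) := by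
  obtain ⟨C, hC, h1, h2⟩ := _root_.exists_norm_scaleAvg_le hβ hβm hB hK
  refine ⟨C * (1 / 2) ^ (-β), by positivity, fun p hp => ?_⟩
  have hρ := rho_pos p
  have hn := hs.norm_le p
  rw [abs_of_nonneg hp] at hn
  rw [mul_assoc, ← Real.mul_rpow (by norm_num) hρ.le]
  rcases le_total (1 / 2 * (1 + ‖p‖)) (τ p) with ht | ht
  · have ht0 : 0 < τ p := lt_of_lt_of_le (by positivity) ht
    refine (h1 _ _ ht0).trans ?_
    gcongr ?_ * ?_
    exact rpow_anti_base (by positivity) ht (by linarith)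
  · refine (h2 _ _ hp).trans ?_
    gcongr ?_ * ?_
    exact rpow_anti_base (by positivity) (by linarith) (by linarith)

lemma HeightSplitting.half_rho_le (hs : HeightSplitting π τ) {p : E} {M : ℝ} (hp : 0 ≤ τ p)
    (hM : M ≤ 1 + ‖p‖) (ht : τ p ≤ M / 4) {z : EuclideanSpace ℝ (Fin m)} (hz : ‖z‖ ≤ 1) :
    1 / 2 * M ≤ 1 + ‖π p - τ p • z‖ := by
  have h1 : ‖π p‖ ≤ ‖π p - τ p • z‖ + ‖τ p • z‖ := by
    simpa using norm_add_le (π p - τ p • z) (τ p • z)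
  have h2 := hs.norm_le p
  rw [norm_smul, Real.norm_of_nonneg hp] at h1
  rw [abs_of_nonneg hp] at h2
  nlinarith [norm_nonneg z]

lemma hasFDerivAt_inv_smul_scaleAvg (hh : Continuous h) {K : EuclideanSpace ℝ (Fin m) → V}
    (hK : UnitKernel K) {p : E} (hp : 0 < τ p) :
    HasFDerivAt (fun q : E => (τ q)⁻¹ • scaleAvg h K (τ q) (π q))
      ((τ p ^ 2)⁻¹ • scaleAvg h (kerDiff π τ (m + 1) K) (τ p) (π p)) p := by
  have := hasFDerivAt_scaleAvg hh hK π τ (m + 1) hp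
  have e1 : (m : ℝ) - (m + 1) = -1 := by ring
  have e2 : (-1 : ℝ) - 1 = -(2 : ℕ) := by norm_num
  simp only [e1, e2, Real.rpow_neg_one] at this
  rwa [Real.rpow_neg hp.le, Real.rpow_natCast] at this

lemma hasFDerivAt_scaleAvg_split (hh : Continuous h) {K : EuclideanSpace ℝ (Fin m) → V}
    (hK : UnitKernel K) {p : E} (hp : 0 < τ p) :
    HasFDerivAt (fun q : E => scaleAvg h K (τ q) (π q))
      ((τ p)⁻¹ • scaleAvg h (kerDiff π τ m K) (τ p) (π p)) p := by
  have := hasFDerivAt_scaleAvg hh hK π τ m hp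
  simpa only [sub_self, Real.rpow_zero, one_smul, zero_sub, Real.rpow_neg_one] using this

lemma hasFDerivAt_smul_scaleAvg (hh : Continuous h) {K : EuclideanSpace ℝ (Fin m) → V}
    (hK : UnitKernel K) {p : E} (hp : 0 < τ p) :
    HasFDerivAt (fun q : E => τ q • scaleAvg h K (τ q) (π q))
      (scaleAvg h (kerDiff π τ (m - 1) K) (τ p) (π p)) p := by
  have := hasFDerivAt_scaleAvg hh hK π τ (m - 1) hp
  simpa only [sub_sub_cancel, sub_self, Real.rpow_zero, one_smul, Real.rpow_one] using this

lemma integral_kerDiff_eq (hτ : ∃ e, τ e = 1) {K : EuclideanSpace ℝ (Fin m) → V}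
    (hK : UnitKernel K) : ∫ z, kerDiff π τ (m - 1) K z = τ.smulRight (∫ z, K z) := by
  obtain ⟨e, he⟩ := hτ
  have h1 := hasFDerivAt_smul_scaleAvg (h := fun _ => 1) (π := π) (τ := τ) (p := e)
    continuous_const hK (by rw [he]; exact one_pos)
  simp only [scaleAvg, one_smul] at h1
  exact h1.unique (τ.hasFDerivAt.smul_const _)

lemma hasFDerivAt_smul_scaleAvg_of_smooth (hs : HeightSplitting π τ)
    (hD : ∀ x, HasFDerivAt h (Dh x) x) (hDc : Continuous Dh) {B : ℝ} (hB : ∀ x, ‖Dh x‖ ≤ B)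
    {K : EuclideanSpace ℝ (Fin m) → V} (hK : UnitKernel K) {p : E} (hp : 0 ≤ τ p) :
    HasFDerivAt (fun q : E => τ q • scaleAvg h K (τ q) (π q))
      (scaleAvg h (kerDiff π τ (m - 1) K) (τ p) (π p)) p := by
  have hhc : Continuous h := continuous_iff_continuousAt.2 fun x => (hD x).continuousAt
  rcases hp.lt_or_eq with hp | hp
  · exact hasFDerivAt_smul_scaleAvg hhc hK hp
  · have h1 := τ.hasFDerivAt.smul (hasFDerivAt_scaleAvg_of_smooth hD hDc hB hK π τ p)
    refine h1.congr_fderiv ?_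
    have hp0 : τ p = 0 := hp.symm
    simp only [hp0, scaleAvg, zero_smul, sub_zero, integral_smul,
      integral_kerDiff_eq hs.exists_one hK, zero_add]
    ext v
    simp only [ContinuousLinearMap.smulRight_apply, smul_apply]
    rw [smul_comm]

section SecondDerivative

variable {K : EuclideanSpace ℝ (Fin m) → V}

lemma scaleAvgDeriv_eq (hD : ∀ x, HasFDerivAt h (Dh x) x) (hDc : Continuous Dh) {B : ℝ}
    (hB : ∀ x, ‖Dh x‖ ≤ B) (hK : UnitKernel K) {p : E} (hp : 0 < τ p) :
    scaleAvgDeriv Dh K π τ p = (τ p)⁻¹ • scaleAvg h (kerDiff π τ m K) (τ p) (π p) :=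
  (hasFDerivAt_scaleAvg_of_smooth hD hDc hB hK π τ p).unique
    (hasFDerivAt_scaleAvg_split
      (continuous_iff_continuousAt.2 fun x => (hD x).continuousAt) hK hp)

lemma hasFDerivAt_scaleAvgDeriv (hD : ∀ x, HasFDerivAt h (Dh x) x) (hDc : Continuous Dh) {B : ℝ}
    (hB : ∀ x, ‖Dh x‖ ≤ B) (hK : UnitKernel K) {p : E} (hp : 0 < τ p) :
    HasFDerivAt (scaleAvgDeriv Dh K π τ) ((τ p ^ 2)⁻¹ •
      scaleAvg h (kerDiff π τ (m + 1) (kerDiff π τ m K)) (τ p) (π p)) p := by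
  refine (hasFDerivAt_inv_smul_scaleAvg
    (continuous_iff_continuousAt.2 fun x => (hD x).continuousAt)
    (hK.kerDiff π τ m) hp).congr_of_eventuallyEq ?_
  filter_upwards [(isOpen_lt continuous_const τ.continuous).mem_nhds hp] with q hq
  exact scaleAvgDeriv_eq hD hDc hB hK hq

omit [CompleteSpace V] in
lemma norm_scaleAvgDeriv_le {DG : EuclideanSpace ℝ (Fin m) → EuclideanSpace ℝ (Fin m) →L[ℝ] ℝ}
    (hK : UnitKernel K) {p : E} {B : ℝ} (hB : ∀ z, ‖z‖ ≤ 1 → ‖DG (π p - τ p • z)‖ ≤ B) :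
    ‖scaleAvgDeriv DG K π τ p‖ ≤ B * ((‖π‖ + ‖τ‖) * ∫ z, ‖K z‖) := by
  rw [← mul_assoc, ← integral_const_mul]
  refine norm_integral_le_of_norm_le (hK.integrable.norm.const_mul _) (Eventually.of_forall fun z => ?_)
  refine (norm_clm_smulRight_le _ hK π τ z).trans ?_
  rcases lt_or_ge 1 ‖z‖ with hz | hz
  · simp [hK.supp z hz]
  · gcongr
    exact hB z hz

omit [CompleteSpace V] in
lemma norm_scaleAvgDeriv_sub_le (hDc : Continuous Dh) (hK : UnitKernel K) {p q : E} {B : ℝ}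
    (hB : ∀ z, ‖z‖ ≤ 1 → ‖Dh (π p - τ p • z) - Dh (π q - τ q • z)‖ ≤ B) :
    ‖scaleAvgDeriv Dh K π τ p - scaleAvgDeriv Dh K π τ q‖ ≤ B * ((‖π‖ + ‖τ‖) * ∫ z, ‖K z‖) := by
  rw [scaleAvgDeriv, scaleAvgDeriv, ← integral_sub (integrable_scaleAvgDeriv_integrand hDc hK π τ p)
    (integrable_scaleAvgDeriv_integrand hDc hK π τ q), ← mul_assoc, ← integral_const_mul]
  refine norm_integral_le_of_norm_le (hK.integrable.norm.const_mul _) (Eventually.of_forall fun z => ?_)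
  have e : ∀ L L' : EuclideanSpace ℝ (Fin m) →L[ℝ] ℝ,
      (L.comp (π - τ.smulRight z)).smulRight (K z) - (L'.comp (π - τ.smulRight z)).smulRight (K z) =
        ((L - L').comp (π - τ.smulRight z)).smulRight (K z) := by
    intro L L'
    ext v
    simp only [sub_apply, ContinuousLinearMap.smulRight_apply,
      ContinuousLinearMap.comp_apply, sub_smul]
  rw [e]
  refine (norm_clm_smulRight_le _ hK π τ z).trans ?_
  rcases lt_or_ge 1 ‖z‖ with hz | hz
  · simp [hK.supp z hz]
  · gcongr
    exact hB z hz

lemma wHolder_scaleAvgDeriv (hs : HeightSplitting π τ) (hα : 0 < α) (hα1 : α < 1) (hβ : 0 < β)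
    (hβm : β < m) (hD : ∀ x, HasFDerivAt h (Dh x) x) {B₀ : ℝ}
    (hB₀ : ∀ x, ‖h x‖ ≤ B₀ * (1 + ‖x‖) ^ (-β)) (hDh : WHolder α (-β - 1) Set.univ Dh)
    (hK : UnitKernel K) : WHolder α (-β - 1) {p | 0 ≤ τ p} (scaleAvgDeriv Dh K π τ) := by
  have hDc : Continuous Dh := continuousOn_univ.1 (hDh.continuousOn hα)
  obtain ⟨B, hB, hDb, hDb'⟩ := hDh
  have hDB : ∀ x, ‖Dh x‖ ≤ B := fun x => (hDb x trivial).trans <|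
    mul_le_of_le_one_right hB <| Real.rpow_le_one_of_one_le_of_nonpos (by simp) (by linarith)
  obtain ⟨C₂, hC₂, h2⟩ := hs.exists_norm_scaleAvg_le hβ hβm hB₀ (hK.kerDiff π τ m)
  obtain ⟨C₃, hC₃, h3⟩ := hs.exists_norm_scaleAvg_le hβ hβm hB₀
    ((hK.kerDiff π τ m).kerDiff π τ (m + 1))
  set I := (‖π‖ + ‖τ‖) * ∫ z, ‖K z‖
  have hI : 0 ≤ I := by positivity
  refine WHolder.of_close hα.le (by linarith) (c := 1 / 16) (by norm_num)
    (C₁ := B * (1 / 2) ^ (-β - 1) * I + 4 * C₂)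
    (C₂ := B * 2 ^ α * (1 / 2) ^ (-β - 1 - α) * I + 64 * C₃ * (1 / 2) ^ (-β))
    (fun p hp => ?_) fun p hp q hq M hM hMp hMq hd hpq => ?_
  · have hp : 0 ≤ τ p := hp
    have hρ := rho_pos p
    rw [add_mul]
    rcases le_total (τ p) ((1 + ‖p‖) / 4) with ht | ht
    · refine (norm_scaleAvgDeriv_le (B := B * (1 / 2 * (1 + ‖p‖)) ^ (-β - 1)) hK
        fun z hz => (hDb _ trivial).trans ?_).trans (le_add_of_le_of_nonneg (le_of_eq ?_)
          (by positivity))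
      · gcongr ?_ * ?_
        exact rpow_anti_base (by positivity) (hs.half_rho_le hp le_rfl ht hz) (by linarith)
      · rw [Real.mul_rpow (by norm_num) hρ.le]
        ring
    · have hp0 : 0 < τ p := lt_of_lt_of_le (by positivity) ht
      refine le_add_of_nonneg_of_le (by positivity) ?_
      rw [scaleAvgDeriv_eq hD hDc hDB hK hp0, norm_smul, Real.norm_of_nonneg (by positivity)]
      calc _ ≤ ((1 + ‖p‖) / 4)⁻¹ * (C₂ * (1 + ‖p‖) ^ (-β)) := by
            gcongr
            exact h2 p hp
        _ = _ := by
            rw [Real.rpow_sub hρ, Real.rpow_one]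
            field_simp
  · have hp : 0 ≤ τ p := hp
    have hq : 0 ≤ τ q := hq
    have hd0 : 0 < ‖p - q‖ := norm_pos_iff.2 (sub_ne_zero.2 hpq)
    rw [add_mul, add_mul]
    by_cases hc : τ p ≤ M / 4 ∧ τ q ≤ M / 4
    · refine (norm_scaleAvgDeriv_sub_le
        (B := B * (2 * ‖p - q‖) ^ α * (1 / 2 * M) ^ (-β - 1 - α)) hDc hK
        fun z hz => (hDb' _ trivial _ trivial (1 / 2 * M) (by positivity)
          (hs.half_rho_le hp hMp hc.1 hz) (hs.half_rho_le hq hMq hc.2 hz)).trans ?_).trans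
          (le_add_of_le_of_nonneg (le_of_eq ?_) (by positivity))
      · gcongr
        have e : π p - τ p • z - (π q - τ q • z) = π (p - q) - τ (p - q) • z := by
          simp only [map_sub, sub_smul]; abel
        rw [e]
        refine (norm_sub_le _ _).trans ?_
        rw [norm_smul, two_mul]
        gcongr
        · exact hs.norm_fst_le _
        · exact (mul_le_of_le_one_right (norm_nonneg _) hz).trans (hs.abs_snd_le _)
      · rw [Real.mul_rpow (by norm_num) hM.le, Real.mul_rpow (by norm_num) hd0.le]
        ring
    · refine le_add_of_nonneg_of_le (by positivity) ?_
      have hpqτ : |τ p - τ q| ≤ M / 16 := by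
        rw [← map_sub]
        exact (hs.abs_snd_le _).trans (by linarith)
      have hqp : ‖q - p‖ = ‖p - q‖ := norm_sub_rev _ _
      have hτz : ∀ z ∈ segment ℝ q p, M / 8 ≤ τ z := by
        intro z hz
        have h1 := (hs.abs_snd_le (z - q)).trans (norm_sub_le_of_mem_segment hz)
        rw [map_sub] at h1
        rw [segment_symm] at hz
        have h2 := (hs.abs_snd_le (z - p)).trans (norm_sub_le_of_mem_segment hz)
        rw [map_sub] at h2
        rw [not_and_or, not_le, not_le] at hc
        rcases hc with hc | hc
        · linarith [(abs_le.1 h2).1]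
        · linarith [(abs_le.1 h1).1]
      have hρz : ∀ z ∈ segment ℝ q p, 1 / 2 * M ≤ 1 + ‖z‖ := by
        intro z hz
        have hz1 := norm_sub_le_of_mem_segment hz
        have hz2 : ‖q‖ ≤ ‖z‖ + ‖z - q‖ := by
          rw [norm_sub_rev]; simpa using norm_add_le z (q - z)
        linarith
      refine ((convex_segment q p).norm_image_sub_le_of_norm_hasFDerivWithin_le
        (fun z hz => (hasFDerivAt_scaleAvgDeriv hD hDc hDB hK
          (lt_of_lt_of_le (by positivity) (hτz z hz))).hasFDerivWithinAt)
        (C := ((M / 8) ^ 2)⁻¹ * (C₃ * (1 / 2 * M) ^ (-β))) (fun z hz => ?_)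
        (left_mem_segment ℝ q p) (right_mem_segment ℝ q p)).trans ?_
      · have hz0 := hτz z hz
        have hz1 : 0 < τ z := lt_of_lt_of_le (by positivity) hz0
        rw [norm_smul, Real.norm_of_nonneg (by positivity)]
        gcongr
        refine (h3 z hz1.le).trans ?_
        gcongr ?_ * ?_
        exact rpow_anti_base (by positivity) (hρz z hz) (by linarith)
      · have hdM : ‖p - q‖ ≤ ‖p - q‖ ^ α * M ^ (1 - α) := by
          calc ‖p - q‖ = ‖p - q‖ ^ α * ‖p - q‖ ^ (1 - α) := by
                rw [← Real.rpow_add hd0]; simp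
            _ ≤ _ := by
                gcongr
                linarith
        calc _ ≤ ((M / 8) ^ 2)⁻¹ * (C₃ * (1 / 2 * M) ^ (-β)) * (‖p - q‖ ^ α * M ^ (1 - α)) := by
              gcongr
          _ = _ := by
              have e : M ^ (-β - 1 - α) = M ^ (-β) * M ^ (1 - α) * (M ^ 2)⁻¹ := by
                rw [← Real.rpow_add hM, ← Real.rpow_natCast, ← Real.rpow_neg hM.le,
                  ← Real.rpow_add hM]
                congr 1
                push_cast
                ring
              rw [Real.mul_rpow (by norm_num) hM.le, e]
              generalize M ^ (-β) = a, M ^ (1 - α) = b, ‖p - q‖ ^ α = c,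
                ((1 : ℝ) / 2) ^ (-β) = d
              field_simp
              ring

end SecondDerivative

/-- Extension of Neumann data from the boundary hyperplane to the half-space. -/
theorem exists_neumann_extension (hs : HeightSplitting π τ) (hα : 0 < α) (hα1 : α < 1) (hβ : 0 < β)
    (hβm : β < m) (hD : ∀ x, HasFDerivAt h (Dh x) x) {B₀ : ℝ}
    (hB₀ : ∀ x, ‖h x‖ ≤ B₀ * (1 + ‖x‖) ^ (-β)) (hDh : WHolder α (-β - 1) Set.univ Dh) :
    ∃ (w : E → ℝ) (W₁ : E → E →L[ℝ] ℝ) (W₂ : E → E →L[ℝ] E →L[ℝ] ℝ),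
      (∀ p, 0 ≤ τ p → HasFDerivAt w (W₁ p) p) ∧ (∀ p, 0 ≤ τ p → HasFDerivAt W₁ (W₂ p) p) ∧
      (∃ C, ∀ p, 0 ≤ τ p → ‖w p‖ ≤ C * (1 + ‖p‖) ^ (1 - β)) ∧
      (∃ C, ∀ p, 0 ≤ τ p → ‖W₁ p‖ ≤ C * (1 + ‖p‖) ^ (-β)) ∧
      WHolder α (-β - 1) {p | 0 ≤ τ p} W₂ ∧
      ∀ p, τ p = 0 → W₁ p = h (π p) • τ := by
  have hm : 0 < m := by
    rcases Nat.eq_zero_or_pos m with rfl | h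
    · simp at hβm; linarith
    · exact h
  obtain ⟨-, φ, -, hφ, hκ, -⟩ := exists_radial_kernel hm
  have hη := hφ.clm_comp ((∫ z, φ z)⁻¹ • ContinuousLinearMap.id ℝ ℝ)
  have hη1 : ∫ z, ((∫ z, φ z)⁻¹ • ContinuousLinearMap.id ℝ ℝ) (φ z) = 1 := by
    simp only [smul_apply, ContinuousLinearMap.id_apply]
    rw [integral_smul, smul_eq_mul, inv_mul_cancel₀ hκ.ne']
  set η := fun z => ((∫ z, φ z)⁻¹ • ContinuousLinearMap.id ℝ ℝ) (φ z)
  have hDc : Continuous Dh := continuousOn_univ.1 (hDh.continuousOn hα)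
  have hDB : ∃ B, ∀ x, ‖Dh x‖ ≤ B := by
    obtain ⟨B, hB, hDb, -⟩ := hDh
    exact ⟨B, fun x => (hDb x trivial).trans <| mul_le_of_le_one_right hB <|
      Real.rpow_le_one_of_one_le_of_nonpos (by simp) (by linarith)⟩
  obtain ⟨B, hB⟩ := hDB
  have hK := hη.kerDiff π τ (m - 1)
  obtain ⟨C₀, hC₀, h0⟩ := hs.exists_norm_scaleAvg_le hβ hβm hB₀ hη
  obtain ⟨C₁, hC₁, h1⟩ := hs.exists_norm_scaleAvg_le hβ hβm hB₀ hK
  refine ⟨fun p => τ p • scaleAvg h η (τ p) (π p),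
    fun p => scaleAvg h (kerDiff π τ (m - 1) η) (τ p) (π p),
    scaleAvgDeriv Dh (kerDiff π τ (m - 1) η) π τ,
    fun p hp => hasFDerivAt_smul_scaleAvg_of_smooth hs hD hDc hB hη hp,
    fun p _ => hasFDerivAt_scaleAvg_of_smooth hD hDc hB hK π τ p, ⟨C₀, fun p hp => ?_⟩,
    ⟨C₁, h1⟩, wHolder_scaleAvgDeriv hs hα hα1 hβ hβm hD hB₀ hDh hK, fun p hp => ?_⟩
  · rw [norm_smul, sub_eq_add_neg, Real.rpow_add (rho_pos p), Real.rpow_one, mul_left_comm]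
    gcongr
    · exact (hs.abs_snd_le p).trans (by simp)
    · exact h0 p hp
  · simp only [hp, scaleAvg, zero_smul, sub_zero, integral_smul,
      integral_kerDiff_eq hs.exists_one hη, hη1]
    ext v
    simp

end NeumannExtension

section Conversion

lemma rpow_mul_le_of_le {r a b C t : ℝ} (hr : 0 < r) (hab : a + b = 0) (h : t ≤ C * r ^ b) :
    r ^ a * t ≤ C := by
  calc r ^ a * t ≤ r ^ a * (C * r ^ b) := by gcongr
    _ = C * r ^ (a + b) := by rw [Real.rpow_add hr]; ring
    _ = C := by rw [hab, Real.rpow_zero, mul_one]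

lemma le_of_rpow_mul_le {r a b C t : ℝ} (hr : 0 < r) (hab : a + b = 0) (h : r ^ a * t ≤ C) :
    t ≤ C * r ^ b := by
  calc t = r ^ (a + b) * t := by rw [hab, Real.rpow_zero, one_mul]
    _ = (r ^ a * t) * r ^ b := by rw [Real.rpow_add hr]; ring
    _ ≤ C * r ^ b := by gcongr

section Within

variable {E : Type*} [NormedAddCommGroup E] [NormedSpace ℝ E] {S : Set E} {u : E → ℝ}
  {U₁ : E → E →L[ℝ] ℝ} {U₂ : E → E →L[ℝ] E →L[ℝ] ℝ}

lemma iteratedFDerivWithin_two_eq (hS : UniqueDiffOn ℝ S)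
    (h1 : ∀ x ∈ S, HasFDerivWithinAt u (U₁ x) S x)
    (h2 : ∀ x ∈ S, HasFDerivWithinAt U₁ (U₂ x) S x) {x : E} (hx : x ∈ S) (v : Fin 2 → E) :
    iteratedFDerivWithin ℝ 2 u S x v = U₂ x (v 0) (v 1) := by
  rw [iteratedFDerivWithin_two_apply _ hS hx,
    fderivWithin_congr (fun y hy => (h1 y hy).fderivWithin (hS y hy))
      ((h1 x hx).fderivWithin (hS x hx)), (h2 x hx).fderivWithin (hS x hx)]

lemma contDiffOn_two_of_hasFDerivWithinAt (hS : UniqueDiffOn ℝ S)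
    (h1 : ∀ x ∈ S, HasFDerivWithinAt u (U₁ x) S x)
    (h2 : ∀ x ∈ S, HasFDerivWithinAt U₁ (U₂ x) S x) (h3 : ContinuousOn U₂ S) :
    ContDiffOn ℝ 2 u S := by
  have hU₁ : ContDiffOn ℝ 1 U₁ S := by
    rw [show (1 : WithTop ℕ∞) = 0 + 1 from rfl, contDiffOn_succ_iff_fderivWithin hS]
    refine ⟨fun x hx => (h2 x hx).differentiableWithinAt, by simp, contDiffOn_zero.2 ?_⟩
    exact h3.congr fun x hx => (h2 x hx).fderivWithin (hS x hx)
  rw [show (2 : WithTop ℕ∞) = 1 + 1 from by norm_num, contDiffOn_succ_iff_fderivWithin hS]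
  exact ⟨fun x hx => (h1 x hx).differentiableWithinAt, by simp,
    hU₁.congr fun x hx => (h1 x hx).fderivWithin (hS x hx)⟩

end Within

variable {n : ℕ} {α γ : ℝ} {S : Set (EuclideanSpace ℝ (Fin n))} {u : EuclideanSpace ℝ (Fin n) → ℝ}

lemma lapWithin_eq_of_hasFDerivWithinAt
    {U₁ : EuclideanSpace ℝ (Fin n) → EuclideanSpace ℝ (Fin n) →L[ℝ] ℝ}
    {U₂ : EuclideanSpace ℝ (Fin n) → EuclideanSpace ℝ (Fin n) →L[ℝ] EuclideanSpace ℝ (Fin n) →L[ℝ] ℝ}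
    (hS : UniqueDiffOn ℝ S) (h1 : ∀ x ∈ S, HasFDerivWithinAt u (U₁ x) S x)
    (h2 : ∀ x ∈ S, HasFDerivWithinAt U₁ (U₂ x) S x) {x : EuclideanSpace ℝ (Fin n)} (hx : x ∈ S) :
    lapWithin n S u x =
      ∑ i, U₂ x (EuclideanSpace.single i 1) (EuclideanSpace.single i 1) := by
  simp only [lapWithin, iteratedFDerivWithin_two_eq hS h1 h2 hx]
  simp

lemma wMemHolder_two_of_hasFDerivWithinAt
    {U₁ : EuclideanSpace ℝ (Fin n) → EuclideanSpace ℝ (Fin n) →L[ℝ] ℝ}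
    {U₂ : EuclideanSpace ℝ (Fin n) → EuclideanSpace ℝ (Fin n) →L[ℝ] EuclideanSpace ℝ (Fin n) →L[ℝ] ℝ}
    (hα : 0 < α) (hS : UniqueDiffOn ℝ S) (h1 : ∀ x ∈ S, HasFDerivWithinAt u (U₁ x) S x)
    (h2 : ∀ x ∈ S, HasFDerivWithinAt U₁ (U₂ x) S x)
    (hu : ∃ C, ∀ x ∈ S, ‖u x‖ ≤ C * (1 + ‖x‖) ^ γ)
    (hU₁ : ∃ C, ∀ x ∈ S, ‖U₁ x‖ ≤ C * (1 + ‖x‖) ^ (γ - 1)) (hU₂ : WHolder α (γ - 2) S U₂) :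
    WMemHolder n 2 α γ S u := by
  obtain ⟨C₀, hC₀⟩ := hu
  obtain ⟨C₁, hC₁⟩ := hU₁
  have hcont := hU₂.continuousOn hα
  obtain ⟨C₂, hC₂, hb, hh⟩ := hU₂
  refine ⟨⟨contDiffOn_two_of_hasFDerivWithinAt hS h1 h2 hcont, fun i hi => ?_⟩, C₂,
    fun x hx y hy hxy hd => ?_⟩
  · interval_cases i
    · refine ⟨C₀, fun x hx => rpow_mul_le_of_le (rho_pos x) (b := γ) (by simp) ?_⟩
      rw [norm_iteratedFDerivWithin_zero]
      exact hC₀ x hx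
    · refine ⟨C₁, fun x hx => rpow_mul_le_of_le (rho_pos x) (b := γ - 1) (by simp) ?_⟩
      rw [norm_iteratedFDerivWithin_one u (hS x hx), (h1 x hx).fderivWithin (hS x hx)]
      exact hC₁ x hx
    · refine ⟨C₂, fun x hx => rpow_mul_le_of_le (rho_pos x) (b := γ - 2) (by simp) ?_⟩
      refine le_trans (ContinuousMultilinearMap.opNorm_le_bound (norm_nonneg (U₂ x)) fun v => ?_)
        (hb x hx)
      rw [iteratedFDerivWithin_two_eq hS h1 h2 hx, Fin.prod_univ_two, ← mul_assoc]
      exact (U₂ x).le_opNorm₂ _ _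
  · have hm : 0 < min (1 + ‖x‖) (1 + ‖y‖) := lt_min (rho_pos x) (rho_pos y)
    refine rpow_mul_le_of_le hm (b := γ - 2 - α) (by push_cast; ring) ?_
    rw [dist_eq_norm]
    refine le_trans (ContinuousMultilinearMap.opNorm_le_bound (norm_nonneg (U₂ x - U₂ y))
      fun v => ?_) (hh x hx y hy _ hm (min_le_left _ _) (min_le_right _ _))
    rw [sub_apply, iteratedFDerivWithin_two_eq hS h1 h2 hx,
      iteratedFDerivWithin_two_eq hS h1 h2 hy, Fin.prod_univ_two, ← mul_assoc]
    exact (U₂ x - U₂ y).le_opNorm₂ _ _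

lemma wHolder_of_forall_dist_le {E V : Type*} [NormedAddCommGroup E] [NormedAddCommGroup V]
    {β : ℝ} {S : Set E} {g : E → V} (hα : 0 ≤ α) (hβ : β ≤ 0)
    (h1 : ∃ M, ∀ x ∈ S, (1 + ‖x‖) ^ (-β) * ‖g x‖ ≤ M)
    (h2 : ∃ M : ℝ, ∀ x ∈ S, ∀ y ∈ S, x ≠ y → dist x y ≤ min (1 + ‖x‖) (1 + ‖y‖) / 2 →
      (min (1 + ‖x‖) (1 + ‖y‖)) ^ (-β + α) * ‖g x - g y‖ ≤ M * dist x y ^ α) :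
    WHolder α β S g := by
  obtain ⟨M₁, h1⟩ := h1
  obtain ⟨M₂, h2⟩ := h2
  refine WHolder.of_close (c := 1 / 2) (C₁ := M₁) (C₂ := |M₂|) hα hβ (by norm_num)
    (fun x hx => le_of_rpow_mul_le (rho_pos x) (by simp) (h1 x hx))
    fun x hx y hy m hm hmx hmy hd hxy => ?_
  have hm' := le_min hmx hmy
  have h := h2 x hx y hy hxy (by rw [dist_eq_norm]; linarith)
  rw [dist_eq_norm] at h
  refine (le_of_rpow_mul_le (hm.trans_le hm') (b := β - α) (by ring) h).trans ?_
  gcongr ?_ * _ ^ _ * ?_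
  · exact le_abs_self _
  · exact rpow_anti_base hm hm' (by linarith)

lemma WMemHolder.wHolder (hα : 0 < α) (hγ : γ ≤ 0) (hu : WMemHolder n 0 α γ S u) :
    WHolder α γ S u := by
  obtain ⟨⟨-, h1⟩, h2⟩ := hu
  refine wHolder_of_forall_dist_le hα.le hγ ?_ ?_
  · simpa using h1 0 le_rfl
  · obtain ⟨M, hM⟩ := h2
    refine ⟨M, fun x hx y hy hxy hd => ?_⟩
    have := hM x hx y hy hxy hd
    rwa [iteratedFDerivWithin_zero_eq_comp, Function.comp_apply, Function.comp_apply, ← map_sub,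
      LinearIsometryEquiv.norm_map, Nat.cast_zero, add_zero] at this

lemma WMemHolder.wHolder_fderiv (hα : 0 < α) (hγ : γ ≤ 1) (hu : WMemHolder n 1 α γ Set.univ u) :
    WHolder α (γ - 1) Set.univ (fderiv ℝ u) := by
  obtain ⟨⟨-, h1⟩, h2⟩ := hu
  refine wHolder_of_forall_dist_le hα.le (by linarith) ?_ ?_
  · obtain ⟨M, hM⟩ := h1 1 le_rfl
    refine ⟨M, fun x hx => ?_⟩
    have := hM x hx
    rw [norm_iteratedFDerivWithin_one u uniqueDiffWithinAt_univ, fderivWithin_univ] at this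
    rw [neg_sub, sub_eq_neg_add]
    simpa using this
  · obtain ⟨M, hM⟩ := h2
    refine ⟨M, fun x hx y hy hxy hd => le_trans ?_ (hM x hx y hy hxy hd)⟩
    rw [show -(γ - 1) + α = -γ + ((1 : ℕ) : ℝ) + α by push_cast; ring]
    gcongr
    refine ContinuousLinearMap.opNorm_le_bound _ (norm_nonneg _) fun v => ?_
    have := (iteratedFDerivWithin ℝ 1 u Set.univ x - iteratedFDerivWithin ℝ 1 u Set.univ y).le_opNorm
      fun _ => v
    simpa [iteratedFDerivWithin_univ] using this

lemma MemCgamma.exists_norm_le {k : ℕ} (hu : MemCgamma n k γ S u) :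
    ∃ C, ∀ x ∈ S, ‖u x‖ ≤ C * (1 + ‖x‖) ^ γ := by
  obtain ⟨M, hM⟩ := hu.2 0 (Nat.zero_le _)
  refine ⟨M, fun x hx => le_of_rpow_mul_le (rho_pos x) (a := -γ) (by simp) ?_⟩
  simpa using hM x hx

end Conversion

section Uniqueness

variable {n : ℕ} {k : Fin n}

lemma convex_upperHalf : Convex ℝ (upperHalf n k) :=
  convex_halfSpace_ge (EuclideanSpace.proj (𝕜 := ℝ) k).isLinear 0

lemma isClosed_upperHalf : IsClosed (upperHalf n k) :=
  isClosed_le continuous_const (EuclideanSpace.proj (𝕜 := ℝ) k).continuous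

lemma upperHalf_mem_nhds {x : EuclideanSpace ℝ (Fin n)} (hx : 0 < x k) : upperHalf n k ∈ 𝓝 x :=
  mem_of_superset ((isOpen_lt continuous_const (EuclideanSpace.proj (𝕜 := ℝ) k).continuous).mem_nhds
    hx) fun y (hy : 0 < y k) => hy.le

lemma uniqueDiffOn_upperHalf : UniqueDiffOn ℝ (upperHalf n k) := by
  refine uniqueDiffOn_convex convex_upperHalf ⟨EuclideanSpace.single k 1, ?_⟩
  exact mem_interior_iff_mem_nhds.2 (upperHalf_mem_nhds (by simp))

lemma deriv_deriv_nonpos_of_isLocalMax {g g' : ℝ → ℝ} {a g'' : ℝ} (hg : IsLocalMax g a)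
    (h1 : ∀ᶠ t in 𝓝 a, HasDerivAt g (g' t) t) (h2 : HasDerivAt g' g'' a) : g'' ≤ 0 := by
  by_contra! hpos
  have e1 : deriv g =ᶠ[𝓝 a] g' := h1.mono fun t ht => ht.deriv
  have hmin : IsLocalMin g a := by
    refine isLocalMin_of_deriv_deriv_pos ?_ hg.deriv_eq_zero h1.self_of_nhds.continuousAt
    rwa [e1.deriv_eq, h2.deriv]
  have hc : g =ᶠ[𝓝 a] fun _ => g a := by
    filter_upwards [hg, hmin] with t ht ht' using le_antisymm ht ht'
  have := hc.deriv.deriv_eq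
  rw [e1.deriv_eq, h2.deriv] at this
  simp at this
  exact hpos.ne' this

variable {d : EuclideanSpace ℝ (Fin n) → ℝ}
  {D₁ : EuclideanSpace ℝ (Fin n) → EuclideanSpace ℝ (Fin n) →L[ℝ] ℝ}
  {D₂ : EuclideanSpace ℝ (Fin n) → EuclideanSpace ℝ (Fin n) →L[ℝ] EuclideanSpace ℝ (Fin n) →L[ℝ] ℝ}

lemma norm_add_smul_single_sq (q : EuclideanSpace ℝ (Fin n)) (i : Fin n) (t : ℝ) :
    ‖q + t • EuclideanSpace.single i (1 : ℝ)‖ ^ 2 = ‖q‖ ^ 2 + 2 * t * q i + t ^ 2 := by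
  rw [norm_add_sq_real, inner_smul_right, EuclideanSpace.inner_single_right, norm_smul]
  simp
  ring

lemma hasDerivAt_add_smul (q v : EuclideanSpace ℝ (Fin n)) (t : ℝ) :
    HasDerivAt (fun t : ℝ => q + t • v) v t := by
  simpa using ((hasDerivAt_id t).smul_const v).const_add q

lemma second_deriv_add_le_of_isLocalMax {q : EuclideanSpace ℝ (Fin n)} {ε : ℝ}
    (h1 : ∀ᶠ x in 𝓝 q, HasFDerivAt d (D₁ x) x) (h2 : HasFDerivAt D₁ (D₂ q) q)
    (hloc : IsLocalMax (fun x : EuclideanSpace ℝ (Fin n) => d x + ε * (‖x‖ ^ 2 + x k)) q)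
    (i : Fin n) : D₂ q (EuclideanSpace.single i 1) (EuclideanSpace.single i 1) + 2 * ε ≤ 0 := by
  have hnorm := norm_add_smul_single_sq q i
  generalize EuclideanSpace.single i (1 : ℝ) = v at hnorm ⊢
  have hl0 : Tendsto (fun t : ℝ => q + t • v) (𝓝 0) (𝓝 q) := by
    simpa using (hasDerivAt_add_smul q v 0).continuousAt.tendsto
  refine deriv_deriv_nonpos_of_isLocalMax (a := 0)
    (g := fun t : ℝ => d (q + t • v) + ε * (‖q‖ ^ 2 + 2 * t * q i + t ^ 2 + (q k + t * v k)))
    (g' := fun t : ℝ => D₁ (q + t • v) v + ε * (2 * q i + 2 * t + v k)) ?_ ?_ ?_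
  · filter_upwards [hl0.eventually hloc] with t ht
    rw [hnorm] at ht
    simpa using ht
  · filter_upwards [hl0.eventually h1] with t ht
    refine (ht.comp_hasDerivAt t (hasDerivAt_add_smul q v t)).add (HasDerivAt.const_mul ε ?_)
    have := (((((hasDerivAt_id t).const_mul 2).mul_const (q i)).const_add (‖q‖ ^ 2)).add
      ((hasDerivAt_id t).pow 2)).add (((hasDerivAt_id t).mul_const (v k)).const_add (q k))
    refine this.congr_deriv ?_
    simp
  · have e : q = q + (0 : ℝ) • v := by simp
    have h3 : HasFDerivAt D₁ (D₂ q) (q + (0 : ℝ) • v) := by rwa [← e]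
    have h4 := (((((hasDerivAt_id (0 : ℝ)).const_mul 2).const_add (2 * q i)).add_const
      (v k)).const_mul ε)
    have h5 : HasDerivAt (fun t : ℝ => D₁ (q + t • v)) (D₂ q v) 0 :=
      h3.comp_hasDerivAt (0 : ℝ) (hasDerivAt_add_smul q v 0)
    have h6 : HasDerivAt (fun t : ℝ => D₁ (q + t • v) v) (D₂ q v v) 0 := by
      simpa using h5.clm_apply (hasDerivAt_const (0 : ℝ) v)
    refine (h6.add h4).congr_deriv ?_
    simp
    ring

/-- A maximum principle for functions on the half-space with vanishing normal derivative. -/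
lemma nonpos_of_laplacian_eq_zero
    (h1 : ∀ x ∈ upperHalf n k, HasFDerivWithinAt d (D₁ x) (upperHalf n k) x)
    (h2 : ∀ x ∈ upperHalf n k, HasFDerivWithinAt D₁ (D₂ x) (upperHalf n k) x)
    (hlap : ∀ x ∈ upperHalf n k,
      ∑ i, D₂ x (EuclideanSpace.single i 1) (EuclideanSpace.single i 1) = 0)
    (hbd : ∀ x, x k = 0 → D₁ x (EuclideanSpace.single k 1) = 0) {γ C : ℝ} (hγ : γ < 0)
    (hd : ∀ x ∈ upperHalf n k, d x ≤ C * (1 + ‖x‖) ^ γ) {p : EuclideanSpace ℝ (Fin n)}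
    (hp : p ∈ upperHalf n k) : d p ≤ 0 := by
  by_contra! hδ
  obtain ⟨R, hR, hRp⟩ : ∃ R, C * (1 + R) ^ γ < d p / 2 ∧ ‖p‖ < R := by
    have ht : Tendsto (fun R : ℝ => C * (1 + R) ^ γ) atTop (𝓝 (C * 0)) := by
      have h := tendsto_rpow_neg_atTop (y := -γ) (by linarith)
      rw [neg_neg] at h
      exact (h.comp (tendsto_atTop_add_const_left _ 1 tendsto_id)).const_mul C
    rw [mul_zero] at ht
    exact ((ht.eventually_lt_const (half_pos hδ)).and (eventually_gt_atTop _)).exists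
  have hR0 : 0 < R := (norm_nonneg p).trans_lt hRp
  obtain ⟨ε, hε, hεR⟩ : ∃ ε, 0 < ε ∧ ε * (R ^ 2 + R) = d p / 2 :=
    ⟨d p / 2 / (R ^ 2 + R), by positivity, by field_simp⟩
  have hcont : ContinuousOn (fun x : EuclideanSpace ℝ (Fin n) => d x + ε * (‖x‖ ^ 2 + x k))
      (upperHalf n k ∩ closedBall 0 R) := by
    have : ContinuousOn d (upperHalf n k ∩ closedBall 0 R) := fun x hx =>
      ((h1 x hx.1).continuousWithinAt).mono Set.inter_subset_left
    fun_prop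
  obtain ⟨q, ⟨hqS, hqR⟩, hq⟩ := ((isCompact_closedBall 0 R).inter_left isClosed_upperHalf).exists_isMaxOn
    ⟨p, hp, by simpa using hRp.le⟩ hcont
  have hqp := hq (show p ∈ _ from ⟨hp, by simpa using hRp.le⟩)
  simp only [Set.mem_ofPred_eq] at hqp
  rw [mem_closedBall_zero_iff] at hqR
  have hqk : |q k| ≤ ‖q‖ := by simpa using PiLp.norm_apply_le q k
  have hpk : 0 ≤ p k := hp
  have hqR' : ‖q‖ < R := by
    refine hqR.lt_of_ne fun h => ?_
    have h3 := hd q hqS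
    rw [h] at h3 hqk hqp
    have : ε * (R ^ 2 + q k) ≤ ε * (R ^ 2 + R) := by
      gcongr
      exact (le_abs_self _).trans hqk
    have : 0 ≤ ε * (‖p‖ ^ 2 + p k) := by positivity
    linarith
  have hloc : IsLocalMaxOn (fun x : EuclideanSpace ℝ (Fin n) => d x + ε * (‖x‖ ^ 2 + x k))
      (upperHalf n k) q := by
    filter_upwards [self_mem_nhdsWithin,
      mem_nhdsWithin_of_mem_nhds (isOpen_ball.mem_nhds (mem_ball_zero_iff.2 hqR'))] with x hx hx'
    exact hq ⟨hx, ball_subset_closedBall hx'⟩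
  rcases (show 0 ≤ q k from hqS).lt_or_eq with hqk0 | hqk0
  · have hmem := upperHalf_mem_nhds hqk0
    have hloc' := hloc.isLocalMax hmem
    have key := fun i => second_deriv_add_le_of_isLocalMax
      (eventually_of_mem (isOpen_interior.mem_nhds (mem_interior_iff_mem_nhds.2 hmem))
        fun x hx => (h1 x (interior_subset hx)).hasFDerivAt (mem_interior_iff_mem_nhds.1 hx))
      ((h2 q hqS).hasFDerivAt hmem) hloc' i
    have hsum := Finset.sum_nonpos fun i (_ : i ∈ Finset.univ) => key i
    rw [Finset.sum_add_distrib, hlap q hqS] at hsum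
    have hn : 0 < (n : ℝ) := by exact_mod_cast k.pos
    simp at hsum
    nlinarith
  · have hT : EuclideanSpace.single k (1 : ℝ) ∈ posTangentConeAt (upperHalf n k) q := by
      refine mem_posTangentConeAt_of_segment_subset (convex_upperHalf.segment_subset hqS ?_)
      simp [upperHalf, ← hqk0]
    have hφ : HasFDerivWithinAt (fun x : EuclideanSpace ℝ (Fin n) => d x + ε * (‖x‖ ^ 2 + x k))
        (D₁ q + ε • (2 • innerSL ℝ q + EuclideanSpace.proj k)) (upperHalf n k) q :=
      (h1 q hqS).add ((((hasStrictFDerivAt_norm_sq q).hasFDerivAt.add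
        (EuclideanSpace.proj (𝕜 := ℝ) k).hasFDerivAt).const_mul ε).hasFDerivWithinAt)
    have := hloc.hasFDerivWithinAt_nonpos hφ hT
    simp [hbd q hqk0.symm, ← hqk0, EuclideanSpace.inner_single_right] at this
    linarith

end Uniqueness

section HalfSpace

/-- The projection of `ℝⁿ` onto its first `n - 1` coordinates. -/
def dropLast (n : ℕ) : EuclideanSpace ℝ (Fin n) →L[ℝ] EuclideanSpace ℝ (Fin (n - 1)) :=
  LinearMap.toContinuousLinearMap
    { toFun := fun x => WithLp.toLp 2 fun i => x (Fin.castLE (Nat.sub_le n 1) i)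
      map_add' := fun _ _ => rfl
      map_smul' := fun _ _ => rfl }

lemma dropLast_apply {n : ℕ} (x : EuclideanSpace ℝ (Fin n)) (i : Fin (n - 1)) :
    dropLast n x i = x (Fin.castLE (Nat.sub_le n 1) i) := rfl

variable {n : ℕ} {k : Fin n}

lemma exists_castLE_eq (hk : (k : ℕ) = n - 1) {i : Fin n} (hi : i ≠ k) :
    ∃ j, Fin.castLE (Nat.sub_le n 1) j = i :=
  ⟨⟨i, by have := Fin.val_ne_of_ne hi; omega⟩, by ext; rfl⟩

lemma castLE_ne (hk : (k : ℕ) = n - 1) (j : Fin (n - 1)) : Fin.castLE (Nat.sub_le n 1) j ≠ k := by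
  intro h
  have := congrArg Fin.val h
  simp at this
  omega

lemma norm_sq_eq_dropLast (hk : (k : ℕ) = n - 1) (x : EuclideanSpace ℝ (Fin n)) :
    ‖x‖ ^ 2 = ‖dropLast n x‖ ^ 2 + (x k) ^ 2 := by
  obtain ⟨m, rfl⟩ : ∃ m, n = m + 1 := ⟨n - 1, by have := k.pos; omega⟩
  have hk' : k = Fin.last m := by ext; simpa using hk
  rw [EuclideanSpace.norm_sq_eq, EuclideanSpace.norm_sq_eq, Fin.sum_univ_castSucc, hk']
  simp only [Real.norm_eq_abs, sq_abs]
  rfl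

lemma heightSplitting_dropLast (hk : (k : ℕ) = n - 1) :
    HeightSplitting (dropLast n) (EuclideanSpace.proj (𝕜 := ℝ) k) where
  norm_fst_le x := by
    have := norm_sq_eq_dropLast hk x
    exact abs_le_of_sq_le_sq' (by nlinarith [sq_nonneg (x k)]) (norm_nonneg x) |>.2
  abs_snd_le x := PiLp.norm_apply_le x k
  norm_le x := by
    have := norm_sq_eq_dropLast hk x
    refine abs_le_of_sq_le_sq' ?_ (by positivity) |>.2
    rw [this, ← sq_abs (x k)]
    change _ ≤ (‖dropLast n x‖ + |x k|) ^ 2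
    nlinarith [mul_nonneg (norm_nonneg (dropLast n x)) (abs_nonneg (x k))]
  exists_one := ⟨EuclideanSpace.single k 1, by simp⟩

lemma emb_apply_castLE (x' : EuclideanSpace ℝ (Fin (n - 1))) (j : Fin (n - 1)) :
    emb n x' (Fin.castLE (Nat.sub_le n 1) j) = x' j := by
  simp [emb, Pi.single_apply, Fin.castLE_inj]

lemma emb_apply_last (hk : (k : ℕ) = n - 1) (x' : EuclideanSpace ℝ (Fin (n - 1))) :
    emb n x' k = 0 := by
  simp [emb, (castLE_ne hk _).symm]

lemma dropLast_emb (x' : EuclideanSpace ℝ (Fin (n - 1))) : dropLast n (emb n x') = x' := by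
  ext i
  rw [dropLast_apply, emb_apply_castLE]

lemma emb_dropLast (hk : (k : ℕ) = n - 1) {x : EuclideanSpace ℝ (Fin n)} (hx : x k = 0) :
    emb n (dropLast n x) = x := by
  ext i
  rcases eq_or_ne i k with rfl | hi
  · rw [emb_apply_last hk, hx]
  · obtain ⟨j, rfl⟩ := exists_castLE_eq hk hi
    rw [emb_apply_castLE, dropLast_apply]

variable (k) in
/-- The reflection of `ℝⁿ` in the hyperplane `{x : x k = 0}`. -/
def flipCoord : EuclideanSpace ℝ (Fin n) ≃ₗᵢ[ℝ] EuclideanSpace ℝ (Fin n) :=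
  LinearIsometryEquiv.piLpCongrRight 2 fun i =>
    if i = k then LinearIsometryEquiv.neg ℝ else LinearIsometryEquiv.refl ℝ ℝ

lemma flipCoord_apply (x : EuclideanSpace ℝ (Fin n)) (i : Fin n) :
    flipCoord k x i = if i = k then -x i else x i := by
  rw [flipCoord, LinearIsometryEquiv.piLpCongrRight_apply]
  split_ifs with h <;> simp [h]

variable (k) in
/-- The folding map of `ℝⁿ` onto the half-space `{x : 0 ≤ x k}`. -/
def foldCoord (x : EuclideanSpace ℝ (Fin n)) : EuclideanSpace ℝ (Fin n) :=
  WithLp.toLp 2 fun i => if i = k then |x i| else x i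

lemma foldCoord_apply (x : EuclideanSpace ℝ (Fin n)) (i : Fin n) :
    foldCoord k x i = if i = k then |x i| else x i := rfl

lemma foldCoord_mem (x : EuclideanSpace ℝ (Fin n)) : foldCoord k x ∈ upperHalf n k := by
  simp [upperHalf, foldCoord_apply]

lemma foldCoord_of_mem {x : EuclideanSpace ℝ (Fin n)} (hx : x ∈ upperHalf n k) :
    foldCoord k x = x := by
  ext i
  rw [foldCoord_apply]
  split_ifs with h
  · subst h
    exact abs_of_nonneg hx
  · rfl

lemma foldCoord_flipCoord (x : EuclideanSpace ℝ (Fin n)) :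
    foldCoord k (flipCoord k x) = foldCoord k x := by
  ext i
  simp only [foldCoord_apply, flipCoord_apply]
  split_ifs <;> simp

lemma norm_foldCoord (x : EuclideanSpace ℝ (Fin n)) : ‖foldCoord k x‖ = ‖x‖ := by
  simp only [EuclideanSpace.norm_eq, foldCoord_apply]
  congr 1
  refine Finset.sum_congr rfl fun i _ => ?_
  split_ifs <;> simp

lemma norm_foldCoord_sub_le (x y : EuclideanSpace ℝ (Fin n)) :
    ‖foldCoord k x - foldCoord k y‖ ≤ ‖x - y‖ := by
  simp only [EuclideanSpace.norm_eq, PiLp.sub_apply, foldCoord_apply]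
  gcongr with i
  split_ifs
  · exact abs_abs_sub_abs_le _ _
  · exact le_rfl

lemma WHolder.mono_set {E V : Type*} [NormedAddCommGroup E] [NormedAddCommGroup V] {α β : ℝ}
    {S T : Set E} {g : E → V} (hg : WHolder α β T g) (hST : S ⊆ T) : WHolder α β S g := by
  obtain ⟨C, hC, h1, h2⟩ := hg
  exact ⟨C, hC, fun x hx => h1 x (hST hx), fun x hx y hy => h2 x (hST hx) y (hST hy)⟩

lemma WHolder.comp_foldCoord {α β : ℝ} {F : EuclideanSpace ℝ (Fin n) → ℝ} (hα : 0 ≤ α)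
    (hF : WHolder α β (upperHalf n k) F) : WHolder α β Set.univ fun x => F (foldCoord k x) := by
  obtain ⟨C, hC, h1, h2⟩ := hF
  refine ⟨C, hC, fun x _ => ?_, fun x _ y _ m hm hx hy => ?_⟩
  · simpa only [norm_foldCoord] using h1 _ (foldCoord_mem x)
  · refine (h2 _ (foldCoord_mem x) _ (foldCoord_mem y) m hm (by rwa [norm_foldCoord])
      (by rwa [norm_foldCoord])).trans ?_
    gcongr
    exact norm_foldCoord_sub_le x y

variable {α γ : ℝ}

lemma fderiv_single_eq_zero_of_flip_invariant {u : EuclideanSpace ℝ (Fin n) → ℝ}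
    {L : EuclideanSpace ℝ (Fin n) →L[ℝ] ℝ} {p : EuclideanSpace ℝ (Fin n)}
    (hu : ∀ x, u (flipCoord k x) = u x) (hL : HasFDerivAt u L p) (hp : p k = 0) :
    L (EuclideanSpace.single k 1) = 0 := by
  have hp' : flipCoord k p = p := by
    ext i
    rw [flipCoord_apply]
    split_ifs with h
    · rw [h, hp, neg_zero]
    · rfl
  have hL' : HasFDerivAt u L (flipCoord k p) := by rwa [hp']
  have h1 := hL'.comp p (flipCoord k).toContinuousLinearEquiv.hasFDerivAt
  have h2 : HasFDerivAt u _ p := h1.congr_of_eventuallyEq (Eventually.of_forall fun x => (hu x).symm)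
  have h3 := DFunLike.congr_fun (h2.unique hL) (EuclideanSpace.single k 1)
  have h4 : flipCoord k (EuclideanSpace.single k (1 : ℝ)) = -EuclideanSpace.single k 1 := by
    ext i
    rw [flipCoord_apply]
    split_ifs with h <;> simp [h]
  have h5 : L (flipCoord k (EuclideanSpace.single k 1)) = L (EuclideanSpace.single k 1) := h3
  rw [h4, map_neg] at h5
  linarith

/-- Solvability of the Neumann problem, with explicit first and second derivatives. -/
lemma exists_neumann_solution (hn : 3 ≤ n) (hk : (k : ℕ) = n - 1) (hα : 0 < α) (hα1 : α < 1)
    (hγ₁ : 2 - (n : ℝ) < γ) (hγ₂ : γ < 0) {f : EuclideanSpace ℝ (Fin n) → ℝ}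
    (hf : WHolder α (γ - 2) (upperHalf n k) f) {h : EuclideanSpace ℝ (Fin (n - 1)) → ℝ}
    {Dh : EuclideanSpace ℝ (Fin (n - 1)) → EuclideanSpace ℝ (Fin (n - 1)) →L[ℝ] ℝ}
    (hD : ∀ x, HasFDerivAt h (Dh x) x) {B : ℝ} (hB : ∀ x, ‖h x‖ ≤ B * (1 + ‖x‖) ^ (γ - 1))
    (hDh : WHolder α (γ - 2) Set.univ Dh) :
    ∃ (u : EuclideanSpace ℝ (Fin n) → ℝ)
      (U₁ : EuclideanSpace ℝ (Fin n) → EuclideanSpace ℝ (Fin n) →L[ℝ] ℝ)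
      (U₂ : EuclideanSpace ℝ (Fin n) →
        EuclideanSpace ℝ (Fin n) →L[ℝ] EuclideanSpace ℝ (Fin n) →L[ℝ] ℝ),
      (∀ x ∈ upperHalf n k, HasFDerivAt u (U₁ x) x) ∧
      (∀ x ∈ upperHalf n k, HasFDerivAt U₁ (U₂ x) x) ∧
      (∃ C, ∀ x ∈ upperHalf n k, ‖u x‖ ≤ C * (1 + ‖x‖) ^ γ) ∧
      (∃ C, ∀ x ∈ upperHalf n k, ‖U₁ x‖ ≤ C * (1 + ‖x‖) ^ (γ - 1)) ∧
      WHolder α (γ - 2) (upperHalf n k) U₂ ∧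
      (∀ x ∈ upperHalf n k,
        ∑ i, U₂ x (EuclideanSpace.single i 1) (EuclideanSpace.single i 1) = f x) ∧
      ∀ x, x k = 0 → U₁ x (EuclideanSpace.single k 1) = h (dropLast n x) := by
  obtain ⟨w, W₁, W₂, hw1, hw2, ⟨A₀, hA₀⟩, ⟨A₁, hA₁⟩, hW₂, hwb⟩ :=
    exists_neumann_extension (heightSplitting_dropLast hk) hα hα1 (β := 1 - γ) (B₀ := B)
      (by linarith) (by rw [Nat.cast_sub (by omega)]; push_cast; linarith) hD
      (by simpa only [neg_sub] using hB) (by convert hDh using 1; ring)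
  rw [show -(1 - γ) - 1 = γ - 2 by ring] at hW₂
  rw [sub_sub_cancel] at hA₀
  rw [neg_sub] at hA₁
  have hF := hf.add (hW₂.clm_comp (-∑ i, (ContinuousLinearMap.apply ℝ ℝ
    (EuclideanSpace.single i (1 : ℝ))).comp (ContinuousLinearMap.apply ℝ
      (EuclideanSpace ℝ (Fin n) →L[ℝ] ℝ) (EuclideanSpace.single i (1 : ℝ)))))
  obtain ⟨v, V₁, V₂, hv1, hv2, ⟨B₀, hB₀⟩, ⟨B₁, hB₁⟩, hV₂, hvl, hvR⟩ :=
    exists_newton_potential hα hα1 hγ₁ hγ₂ (hF.comp_foldCoord hα.le)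
  have hvinv := hvR (flipCoord k) fun x => by rw [foldCoord_flipCoord]
  refine ⟨fun x => w x + v x, fun x => W₁ x + V₁ x, fun x => W₂ x + V₂ x,
    fun x hx => (hw1 x hx).add (hv1 x), fun x hx => (hw2 x hx).add (hv2 x), ⟨A₀ + B₀, fun x hx => ?_⟩,
    ⟨A₁ + B₁, fun x hx => ?_⟩, hW₂.add (hV₂.mono_set (Set.subset_univ _)), fun x hx => ?_, fun x hx => ?_⟩
  · rw [add_mul]
    exact norm_add_le_of_le (hA₀ x hx) (hB₀ x)
  · rw [add_mul]
    exact norm_add_le_of_le (hA₁ x hx) (hB₁ x)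
  · simp only [add_apply, Finset.sum_add_distrib, hvl, foldCoord_of_mem hx]
    simp
  · rw [add_apply, fderiv_single_eq_zero_of_flip_invariant hvinv (hv1 x) hx, hwb x hx]
    simp

end HalfSpace

lemma le_of_neumann {n : ℕ} {k : Fin n} (hk : (k : ℕ) = n - 1) {α γ : ℝ} (hγ : γ < 0)
    {f : EuclideanSpace ℝ (Fin n) → ℝ} {fbar : EuclideanSpace ℝ (Fin (n - 1)) → ℝ}
    {u v : EuclideanSpace ℝ (Fin n) → ℝ} (hu : WMemHolder n 2 α γ (upperHalf n k) u)
    (hv : WMemHolder n 2 α γ (upperHalf n k) v)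
    (hul : ∀ x ∈ upperHalf n k, lapWithin n (upperHalf n k) u x = f x)
    (hvl : ∀ x ∈ upperHalf n k, lapWithin n (upperHalf n k) v x = f x)
    (hub : ∀ x', fderivWithin ℝ u (upperHalf n k) (emb n x') (EuclideanSpace.single k 1) = fbar x')
    (hvb : ∀ x', fderivWithin ℝ v (upperHalf n k) (emb n x') (EuclideanSpace.single k 1) = fbar x') :
    ∀ x ∈ upperHalf n k, v x ≤ u x := by
  have h1 : ∀ u, WMemHolder n 2 α γ (upperHalf n k) u → ∀ x ∈ upperHalf n k,
      HasFDerivWithinAt u (fderivWithin ℝ u (upperHalf n k) x) (upperHalf n k) x := fun u hu x hx =>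
    (hu.1.1.differentiableOn (by norm_num) x hx).hasFDerivWithinAt
  have h2 : ∀ u, WMemHolder n 2 α γ (upperHalf n k) u → ∀ x ∈ upperHalf n k,
      HasFDerivWithinAt (fderivWithin ℝ u (upperHalf n k))
        (fderivWithin ℝ (fderivWithin ℝ u (upperHalf n k)) (upperHalf n k) x)
        (upperHalf n k) x := fun u hu x hx =>
    ((hu.1.1.fderivWithin uniqueDiffOn_upperHalf (m := 1) (by norm_num)).differentiableOn
      (by norm_num) x hx).hasFDerivWithinAt
  obtain ⟨A, hA⟩ := hu.1.exists_norm_le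
  obtain ⟨B, hB⟩ := hv.1.exists_norm_le
  intro x hx
  refine sub_nonpos.1 (nonpos_of_laplacian_eq_zero (γ := γ) (C := B + A)
    (fun x hx => (h1 v hv x hx).sub (h1 u hu x hx))
    (fun x hx => (h2 v hv x hx).sub (h2 u hu x hx)) (fun x hx => ?_) (fun x hx => ?_) hγ
    (fun x hx => ?_) hx)
  · have e1 := lapWithin_eq_of_hasFDerivWithinAt uniqueDiffOn_upperHalf (h1 v hv) (h2 v hv) hx
    have e2 := lapWithin_eq_of_hasFDerivWithinAt uniqueDiffOn_upperHalf (h1 u hu) (h2 u hu) hx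
    simp only [sub_apply, Finset.sum_sub_distrib]
    rw [← e1, ← e2, hul x hx, hvl x hx, sub_self]
  · have e1 := hub (dropLast n x)
    have e2 := hvb (dropLast n x)
    rw [emb_dropLast hk hx] at e1 e2
    rw [sub_apply, e1, e2, sub_self]
  · rw [add_mul]
    exact (le_abs_self _).trans (norm_sub_le_of_le (hB x hx) (hA x hx))

/-- for `n ≥ 3`, `0 < α < 1` and `2 - n < γ < 0`, and for any
`f ∈ C^{0,α}_{γ-2}(ℝⁿ₊)` and `f̄ ∈ C^{1,α}_{γ-1}(∂ℝⁿ₊)`, there is a unique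
`u ∈ C^{2,α}_γ(ℝⁿ₊)` with `Δu = f` on `ℝⁿ₊` and `∂u/∂xₙ = f̄` on `∂ℝⁿ₊`. -/
theorem stmt_6 (n : ℕ) (hn : 3 ≤ n) (α γ : ℝ) (hα₁ : 0 < α) (hα₂ : α < 1)
    (hγ₁ : 2 - (n : ℝ) < γ) (hγ₂ : γ < 0)
    (f : EuclideanSpace ℝ (Fin n) → ℝ)
    (hf : WMemHolder n 0 α (γ - 2) (upperHalf n ⟨n - 1, by omega⟩) f)
    (fbar : EuclideanSpace ℝ (Fin (n - 1)) → ℝ)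
    (hfbar : WMemHolder (n - 1) 1 α (γ - 1) Set.univ fbar) :
    ∃ u : EuclideanSpace ℝ (Fin n) → ℝ,
      (WMemHolder n 2 α γ (upperHalf n ⟨n - 1, by omega⟩) u ∧
        (∀ x ∈ upperHalf n ⟨n - 1, by omega⟩,
          lapWithin n (upperHalf n ⟨n - 1, by omega⟩) u x = f x) ∧
        (∀ x' : EuclideanSpace ℝ (Fin (n - 1)),
          fderivWithin ℝ u (upperHalf n ⟨n - 1, by omega⟩) (emb n x')
            (EuclideanSpace.single ⟨n - 1, by omega⟩ 1) = fbar x')) ∧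
      ∀ v : EuclideanSpace ℝ (Fin n) → ℝ,
        (WMemHolder n 2 α γ (upperHalf n ⟨n - 1, by omega⟩) v ∧
          (∀ x ∈ upperHalf n ⟨n - 1, by omega⟩,
            lapWithin n (upperHalf n ⟨n - 1, by omega⟩) v x = f x) ∧
          (∀ x' : EuclideanSpace ℝ (Fin (n - 1)),
            fderivWithin ℝ v (upperHalf n ⟨n - 1, by omega⟩) (emb n x')
              (EuclideanSpace.single ⟨n - 1, by omega⟩ 1) = fbar x')) →
        Set.EqOn v u (upperHalf n ⟨n - 1, by omega⟩) := by
  have hn0 : n - 1 < n := by omega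
  have hS := uniqueDiffOn_upperHalf (k := ⟨n - 1, hn0⟩)
  have hk : ((⟨n - 1, hn0⟩ : Fin n) : ℕ) = n - 1 := rfl
  have hdiff : Differentiable ℝ fbar :=
    (contDiffOn_univ.1 hfbar.1.1).differentiable (by norm_num)
  obtain ⟨B, hB⟩ := hfbar.1.exists_norm_le
  have hDh := hfbar.wHolder_fderiv hα₁ (by linarith)
  rw [show γ - 1 - 1 = γ - 2 by ring] at hDh
  obtain ⟨u, U₁, U₂, h1, h2, hu, hU₁, hU₂, hlap, hbd⟩ := exists_neumann_solution hn hk hα₁ hα₂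
    hγ₁ hγ₂ (hf.wHolder hα₁ (by linarith)) (fun x => (hdiff x).hasFDerivAt)
    (fun x => hB x trivial) hDh
  have h1' := fun x hx => (h1 x hx).hasFDerivWithinAt (s := upperHalf n ⟨n - 1, hn0⟩)
  have h2' := fun x hx => (h2 x hx).hasFDerivWithinAt (s := upperHalf n ⟨n - 1, hn0⟩)
  have hmem : WMemHolder n 2 α γ (upperHalf n ⟨n - 1, hn0⟩) u :=
    wMemHolder_two_of_hasFDerivWithinAt hα₁ hS h1' h2' hu hU₁ hU₂
  have hul : ∀ x ∈ upperHalf n ⟨n - 1, hn0⟩, lapWithin n (upperHalf n ⟨n - 1, hn0⟩) u x = f x :=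
    fun x hx => (lapWithin_eq_of_hasFDerivWithinAt hS h1' h2' hx).trans (hlap x hx)
  have hub : ∀ x', fderivWithin ℝ u (upperHalf n ⟨n - 1, hn0⟩) (emb n x')
      (EuclideanSpace.single ⟨n - 1, hn0⟩ 1) = fbar x' := fun x' => by
    have h0 := emb_apply_last hk x'
    have hx : emb n x' ∈ upperHalf n ⟨n - 1, hn0⟩ := h0.ge
    rw [(h1' _ hx).fderivWithin (hS _ hx), hbd _ h0, dropLast_emb]
  exact ⟨u, ⟨hmem, hul, hub⟩, fun v ⟨hv, hvl, hvb⟩ x hx =>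
    le_antisymm (le_of_neumann hk hγ₂ hmem hv hul hvl hub hvb x hx)
      (le_of_neumann hk hγ₂ hv hmem hvl hul hvb hub x hx)⟩
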